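/- arXiv:2307.15866 — 2 statements merged into one kernel-verified Lean document; each statement's English description precedes it below -/
import Mathlib

section
/- Assume S = ℤ + 1/2 (so ε = 0). Let μ = (μ_1 ≥ μ_2 ≥ … ≥ μ_n ≥ 0) be a partition with μ_{n+1} := 0, and set v_{μ,S} := A_1^{μ_1−μ_2} A_2^{μ_2−μ_3} ⋯ A_{n−1}^{μ_{n−1}−μ_n} A_n^{μ_n} |0⟩ ∈ F_N(S). Then v_{μ,S} is nonzero and: (a) ( Σ_{r∈S} q^{−br} Σ_{k=1}^{n} ( :psi_i^k(a−r) psibar_j^k(r): − :psi_{m+1−j}^k(r) psibar_{m+1−i}^k(a−r): ) ) v_{μ,S} = 0 for all 1 ≤ i, j ≤ m and a, b ∈ ℤ with a > 0, or a = 0 and i < j; (b) ( Σ_{r∈S} q^{−br} Σ_{k=1}^{n} ( :psi_i^k(−r) psibar_i^k(r): − :psi_{m+1−i}^k(r) psibar_{m+1−i}^k(−r): ) − 2nω_S(b)·Id ) v_{μ,S} = ( Σ_{k=1}^{n} (μ_k − μ_{k+1}) Σ_{r∈J^S_{i,k}} q^{−br} − Σ_{k=1}^{n} (μ_k − μ_{k+1})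 Σ_{r∈J^S_{m+1−i,k}} q^{br} − 2nω_S(b) ) v_{μ,S} for all 1 ≤ i ≤ m and b ∈ ℤ; (c) ( Σ_{k=1}^{m} Σ_{r∈S} :psi_k^p(−r) psibar_k^s(r): ) v_{μ,S} = 0 for all 1 ≤ p < s ≤ n; (d) ( Σ_{k=1}^{m} Σ_{r∈S} :psi_k^p(−r) psi_{m+1−k}^s(r): ) v_{μ,S} = 0 for all 1 ≤ p ≤ s ≤ n; (e) ( Σ_{k=1}^{m} Σ_{r∈S} :psi_k^p(−r) psibar_k^p(r): ) v_{μ,S} = μ_p v_{μ,S} for all 1 ≤ p ≤ n. That is, v_{μ,S} is a joint highest weight vector for the dual pair (Sp_{2n}, sohat_m(C_q)) on F_N(ℤ+1/2). -/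
noncomputable section

/-- Context for the enlarged Weyl algebra `W_N(S)` with `N = m·n` and
`S = ℤ` (encoded by `sig = 0`) or `S = ℤ + 1/2` (encoded by `sig = 1`).
An element `r ∈ S` is encoded by the unique integer `k` with `r = k + sig/2`,
so that `ε := 1/2 - sig/2` and e.g. `r > 0 ↔ 0 < 2k + sig`.
The data also fixes a generic `q ∈ ℂˣ` together with a square root `sq` of `q`. -/
structure WCtx where
  m : ℕ
  n : ℕ
  hm : 0 < m
  hn : 0 < n
  sig : ℤ
  hsig : sig = 0 ∨ sig = 1
  q : ℂ
  sq : ℂ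
  hsq : sq ^ 2 = q
  hq0 : q ≠ 0
  hqu : ∀ k : ℕ, k ≠ 0 → q ^ k ≠ 1

namespace WCtx

variable (C : WCtx)

/-- `N = m n`. -/
def NN : ℕ := C.m * C.n

/-- Names of the generators of `W_N(S)`: `Sum.inl i` is `ψ_{i+1}` and
`Sum.inr i` is `ψ̄_{i+1}`; the integer `k` encodes the index `r = k + sig/2 ∈ S`. -/
abbrev Gen : Type := (Fin C.NN ⊕ Fin C.NN) × ℤ

/-- The defining relations of the enlarged Weyl algebra `W_N(S)`:
any two `ψ`'s commute, any two `ψ̄`'s commute, and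
`ψ̄_i(k)ψ_j(r) − ψ_j(r)ψ̄_i(k) = δ_{i,j} δ_{k+r,0}`. -/
inductive rel : FreeAlgebra ℂ C.Gen → FreeAlgebra ℂ C.Gen → Prop
  | comm_psi (i j : Fin C.NN) (k l : ℤ) :
      rel (FreeAlgebra.ι ℂ ((Sum.inl i, k) : C.Gen) * FreeAlgebra.ι ℂ ((Sum.inl j, l) : C.Gen))
          (FreeAlgebra.ι ℂ ((Sum.inl j, l) : C.Gen) * FreeAlgebra.ι ℂ ((Sum.inl i, k) : C.Gen))
  | comm_psibar (i j : Fin C.NN) (k l : ℤ) :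
      rel (FreeAlgebra.ι ℂ ((Sum.inr i, k) : C.Gen) * FreeAlgebra.ι ℂ ((Sum.inr j, l) : C.Gen))
          (FreeAlgebra.ι ℂ ((Sum.inr j, l) : C.Gen) * FreeAlgebra.ι ℂ ((Sum.inr i, k) : C.Gen))
  | mixed (i j : Fin C.NN) (k l : ℤ) :
      rel (FreeAlgebra.ι ℂ ((Sum.inr i, k) : C.Gen) * FreeAlgebra.ι ℂ ((Sum.inl j, l) : C.Gen))
          (FreeAlgebra.ι ℂ ((Sum.inl j, l) : C.Gen) * FreeAlgebra.ι ℂ ((Sum.inr i, k) : C.Gen)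
            + (if i = j ∧ k + l + C.sig = 0 then 1 else 0))

/-- The enlarged Weyl algebra `W_N(S)`. -/
def W : Type := RingQuot C.rel

instance : Ring C.W := inferInstanceAs (Ring (RingQuot C.rel))
instance : Algebra ℂ C.W := inferInstanceAs (Algebra ℂ (RingQuot C.rel))

/-- `ψ` with `0`-indexed flat subscript. -/
def psi0 (i : Fin C.NN) (k : ℤ) : C.W :=
  RingQuot.mkAlgHom ℂ C.rel (FreeAlgebra.ι ℂ ((Sum.inl i, k) : C.Gen))

/-- `ψ̄` with `0`-indexed flat subscript. -/
def psibar0 (i : Fin C.NN) (k : ℤ) : C.W :=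
  RingQuot.mkAlgHom ℂ C.rel (FreeAlgebra.ι ℂ ((Sum.inr i, k) : C.Gen))

/-- `ψ_i(r)` with `1`-indexed flat subscript `i ∈ {1,…,N}` (junk value `0` outside). -/
def psiF (i : ℕ) (k : ℤ) : C.W :=
  if h : 1 ≤ i ∧ i ≤ C.NN then C.psi0 ⟨i - 1, by omega⟩ k else 0

/-- `ψ̄_i(r)` with `1`-indexed flat subscript `i ∈ {1,…,N}` (junk value `0` outside). -/
def psibarF (i : ℕ) (k : ℤ) : C.W :=
  if h : 1 ≤ i ∧ i ≤ C.NN then C.psibar0 ⟨i - 1, by omega⟩ k else 0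

/-- `ψ_i^c(r) = ψ_{i+(c-1)m}(r)`, subscript `i ∈ {1,…,m}`, superscript `c ∈ {1,…,n}`. -/
def psiS (i c : ℕ) (k : ℤ) : C.W := C.psiF (i + (c - 1) * C.m) k

/-- `ψ̄_i^c(r) = ψ̄_{i+(c-1)m}(r)`. -/
def psibarS (i c : ℕ) (k : ℤ) : C.W := C.psibarF (i + (c - 1) * C.m) k

/-- The left ideal of `W_N(S)` generated by all `ψ_i(r), ψ̄_i(r)` with `r > 0`,
together with all `ψ̄_i(0)` when `S = ℤ`. -/
def vacIdeal : Submodule C.W C.W :=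
  Submodule.span C.W
    {w : C.W |
      (∃ (i : Fin C.NN) (k : ℤ), 0 < 2 * k + C.sig ∧ (w = C.psi0 i k ∨ w = C.psibar0 i k)) ∨
        (C.sig = 0 ∧ ∃ i : Fin C.NN, w = C.psibar0 i 0)}

/-- The Fock module `F_N(S) = W_N(S)/I`. -/
def F : Type := C.W ⧸ C.vacIdeal

instance : AddCommGroup C.F := inferInstanceAs (AddCommGroup (C.W ⧸ C.vacIdeal))
instance : Module C.W C.F := inferInstanceAs (Module C.W (C.W ⧸ C.vacIdeal))
instance : Module ℂ C.F := inferInstanceAs (Module ℂ (C.W ⧸ C.vacIdeal))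

/-- The vacuum vector `|0⟩ ∈ F_N(S)`. -/
def vac : C.F := Submodule.Quotient.mk (1 : C.W)

/-- Normal ordering `:u(k) v(l):` where `l` encodes the `S`-index of the second factor. -/
def nord (u : C.W) (l : ℤ) (v : C.W) : C.W :=
  if 0 < 2 * l + C.sig then u * v
  else if 2 * l + C.sig = 0 then (2 : ℂ)⁻¹ • (u * v + v * u)
  else v * u

/-- `ε = 0` if `S = ℤ + 1/2`, `ε = 1/2` if `S = ℤ`, as a complex number. -/
def eps : ℂ := (1 - (C.sig : ℂ)) / 2

/-- `ω_S(b)`. -/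
def om (b : ℤ) : ℂ :=
  if b = 0 then 0
  else if C.sig = 0 then (2 : ℂ)⁻¹ * ((C.q ^ b + 1) / (C.q ^ b - 1))
  else C.sq ^ b / (C.q ^ b - 1)

/-- `q^{-b r}` for `r = k + sig/2 ∈ S`. -/
def qp (b k : ℤ) : ℂ := C.sq ^ (-(b * (2 * k + C.sig)))

/-- `q^{b r}` for `r = k + sig/2 ∈ S`. -/
def qpp (b k : ℤ) : ℂ := C.sq ^ (b * (2 * k + C.sig))

/-- `φ^c_{t + sig/2}`; here `t ∈ ℤ` encodes the half-integer index `t + sig/2 = t + 1/2 - ε`.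
Writing `t = (k + sig)m - i` with `1 ≤ i ≤ m`, `k ∈ ℤ`, this is `ψ_i^c(k + sig/2)`. -/
def PhiW (c : ℕ) (t : ℤ) : C.W :=
  C.psiF ((((-t - 1).emod C.m).toNat + 1) + (c - 1) * C.m)
    ((t + (-t - 1).emod C.m + 1) / C.m - C.sig)

/-- `φ̄^c_{t + sig/2}`; writing `t = k·m + i - 1` with `1 ≤ i ≤ m`, `k ∈ ℤ`,
this is `ψ̄_i^c(k + sig/2)`. -/
def PhibarW (c : ℕ) (t : ℤ) : C.W :=
  C.psibarF (((t.emod C.m).toNat + 1) + (c - 1) * C.m) ((t - t.emod C.m) / C.m)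

/-- Determinant of a square matrix with (pairwise commuting) entries in `W_N(S)`. -/
def ncdet {l : ℕ} (M : Fin l → Fin l → C.W) : C.W :=
  ∑ p : Equiv.Perm (Fin l),
    (((Equiv.Perm.sign p : ℤˣ) : ℤ)) • ((List.finRange l).map fun t => M (p t) t).prod

/-- The element `A_l ∈ W_N(S)`, `1 ≤ l ≤ n`. -/
def Adet (l : ℕ) : C.W :=
  C.ncdet fun k t : Fin l => C.PhiW ((k : ℕ) + 1) (-(((t : ℕ) : ℤ) + 1))

/-- The element `Ā_l ∈ W_N(S)`, `1 ≤ l ≤ n`. -/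
def Abar (l : ℕ) : C.W :=
  C.ncdet fun s t : Fin (C.n - l + 1) => C.PhibarW (C.n - (s : ℕ)) (-(((t : ℕ) : ℤ) + 1))

/-- `α(r,a,i) = (a - r + 1/2 - ε)m - i + 1 = (a-k)m - i + 1` for `r = k + sig/2`. -/
def alphaV (k a : ℤ) (i : ℕ) : ℤ := (a - k) * C.m - (i : ℤ) + 1

/-- `β(r,a,j) = (r + a - 1/2 + ε)m + j = (k+a)m + j` for `r = k + sig/2`. -/
def betaV (k a : ℤ) (j : ℕ) : ℤ := (k + a) * C.m + (j : ℤ)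

/-- `Σ_{c=1}^{n} ψ_i^c(a-r) ψ̄_j^c(r)`, where `k` encodes `r`. -/
def Esum (i j : ℕ) (a k : ℤ) : C.W :=
  ∑ c : Fin C.n, C.psiS i ((c : ℕ) + 1) (a - k - C.sig) * C.psibarS j ((c : ℕ) + 1) k

/-- `A_l^{i,j,r}`: `A_l` with the `β(r,0,j)`-th column replaced by
`(φ^1_{α(r,a,i)-1/2-ε}, …, φ^l_{α(r,a,i)-1/2-ε})ᵗ`. -/
def Amod (l : ℕ) (i j : ℕ) (a k : ℤ) : C.W :=
  C.ncdet fun r t : Fin l =>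
    if (((t : ℕ) : ℤ) + 1) = C.betaV k 0 j then C.PhiW ((r : ℕ) + 1) (C.alphaV k a i - 1)
    else C.PhiW ((r : ℕ) + 1) (-(((t : ℕ) : ℤ) + 1))

/-- `Ā_l^{i,j,r}`: `Ā_l` with the `α(r,a,i)`-th column replaced by
`(-φ̄^n_{β(r,0,j)-1/2-ε}, …, -φ̄^l_{β(r,0,j)-1/2-ε})ᵗ`. -/
def Abarmod (l : ℕ) (i j : ℕ) (a k : ℤ) : C.W :=
  C.ncdet fun s t : Fin (C.n - l + 1) =>
    if (((t : ℕ) : ℤ) + 1) = C.alphaV k a i then -C.PhibarW (C.n - (s : ℕ)) (C.betaV k 0 j - 1)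
    else C.PhibarW (C.n - (s : ℕ)) (-(((t : ℕ) : ℤ) + 1))

/-- `l̄₁` for `l = l₁ m + l₂`, `1 ≤ l₂ ≤ m`. -/
def lb1 (l : ℕ) : ℕ :=
  if (l - 1) / C.m % 2 = 0 then ((l - 1) / C.m / 2) * C.m + ((l - 1) % C.m + 1)
  else (((l - 1) / C.m + 1) / 2) * C.m

/-- `l̄₂ = l - l̄₁`. -/
def lb2 (l : ℕ) : ℕ := l - C.lb1 l

/-- The `(k,t)` entry of the matrix defining `B_l`. -/
def Bentry (l : ℕ) (k t : Fin l) : C.W :=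
  if (t : ℕ) + 1 ≤ C.lb1 l then C.PhiW ((k : ℕ) + 1) (-(((t : ℕ) : ℤ) + 1))
  else C.PhibarW (C.n - (k : ℕ)) (-((((t : ℕ) : ℤ) + 1) - (C.lb1 l : ℤ)))

/-- The element `B_l ∈ W_N(S)`, `1 ≤ l ≤ n`. -/
def Bdet (l : ℕ) : C.W := C.ncdet (C.Bentry l)

/-- The element `B̄_{n/2} ∈ W_N(S)` (`n` even): `B_{n/2}` with its `(n/2)`-th row replaced. -/
def Bbar : C.W :=
  C.ncdet fun k t : Fin (C.n / 2) =>
    if (k : ℕ) + 1 = C.n / 2 then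
      (if (t : ℕ) + 1 ≤ C.lb1 (C.n / 2) then C.PhiW (C.n / 2 + 1) (-(((t : ℕ) : ℤ) + 1))
       else C.PhibarW (C.n / 2) (-((((t : ℕ) : ℤ) + 1) - (C.lb1 (C.n / 2) : ℤ))))
    else C.Bentry (C.n / 2) k t

/-- `B_l` with its `pos`-th column replaced by the column `(col 1, …, col l)ᵗ`. -/
def Bcolrep (l : ℕ) (pos : ℤ) (col : ℕ → C.W) : C.W :=
  C.ncdet fun k t : Fin l =>
    if (((t : ℕ) : ℤ) + 1) = pos then col ((k : ℕ) + 1) else C.Bentry l k t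

/-- The operator `T_{i,j}(a,b) = Σ_{r∈S} q^{-br} Σ_{c=1}^n :ψ_i^c(a-r) ψ̄_j^c(r):`. -/
def Top (i j : ℕ) (a b : ℤ) (x : C.F) : C.F :=
  ∑ᶠ k : ℤ, (C.qp b k • ∑ c : Fin C.n,
    C.nord (C.psiS i ((c : ℕ) + 1) (a - k - C.sig)) k (C.psibarS j ((c : ℕ) + 1) k)) • x

/-- The operator `S_{i,j}(c,d) = Σ_{e=1}^n ψ_i^e(c) ψ̄_j^e(d)`. -/
def Sop (i j : ℕ) (c d : ℤ) (x : C.F) : C.F :=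
  (∑ e : Fin C.n, C.psiS i ((e : ℕ) + 1) c * C.psibarS j ((e : ℕ) + 1) d) • x

/-- The operator `E_{p,p} = Σ_{c=1}^m Σ_{r∈S} :ψ_c^p(-r) ψ̄_c^p(r): − ε m`. -/
def Epp (p : ℕ) (x : C.F) : C.F :=
  (∑ᶠ k : ℤ, (∑ c : Fin C.m,
      C.nord (C.psiS ((c : ℕ) + 1) p (-k - C.sig)) k (C.psibarS ((c : ℕ) + 1) p k)) • x)
    - (C.eps * (C.m : ℂ)) • x

/-- The operator `E_i(b) = Σ_{r∈S} q^{-br} Σ_{c=1}^n :ψ_i^c(-r) ψ̄_i^c(r): − n ω_S(b)`. -/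
def Eib (i : ℕ) (b : ℤ) (x : C.F) : C.F :=
  (∑ᶠ k : ℤ, (C.qp b k • ∑ c : Fin C.n,
      C.nord (C.psiS i ((c : ℕ) + 1) (-k - C.sig)) k (C.psibarS i ((c : ℕ) + 1) k)) • x)
    - ((C.n : ℂ) * C.om b) • x

/-- `Σ_{r ∈ J^S_{i,l}} q^{-br}`. -/
def Jsum (i l : ℕ) (b : ℤ) : ℂ :=
  ∑ᶠ k ∈ {k : ℤ | 1 ≤ k * (C.m : ℤ) + (i : ℤ) ∧ k * (C.m : ℤ) + (i : ℤ) ≤ (l : ℤ)}, C.qp b k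

/-- `Σ_{r ∈ J̄^S_{i,l}} q^{-br}`. -/
def Jbarsum (i l : ℕ) (b : ℤ) : ℂ :=
  ∑ᶠ k ∈ {k : ℤ | 1 ≤ -(k * (C.m : ℤ)) - (i : ℤ) + 1 ∧ -(k * (C.m : ℤ)) - (i : ℤ) + 1 ≤ (l : ℤ)},
    C.qp b k

/-- `Σ_{r ∈ J^S_{i,l}} q^{br}`. -/
def JsumP (i l : ℕ) (b : ℤ) : ℂ :=
  ∑ᶠ k ∈ {k : ℤ | 1 ≤ k * (C.m : ℤ) + (i : ℤ) ∧ k * (C.m : ℤ) + (i : ℤ) ≤ (l : ℤ)}, C.qpp b k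

/-- `Σ_{c=1}^m ψ_c^p(-r) ψ̄_c^{p+1}(r)` (no normal ordering), `k` encoding `r ∈ S`. -/
def glRaise (p : ℕ) (k : ℤ) : C.W :=
  ∑ c : Fin C.m, C.psiS ((c : ℕ) + 1) p (-k - C.sig) * C.psibarS ((c : ℕ) + 1) (p + 1) k

/-- The operator `Σ_{c=1}^m Σ_{r∈S} :ψ_c^p(-r) ψ̄_c^{p+1}(r):`. -/
def glRaiseOp (p : ℕ) (x : C.F) : C.F :=
  ∑ᶠ k : ℤ, (∑ c : Fin C.m,
    C.nord (C.psiS ((c : ℕ) + 1) p (-k - C.sig)) k (C.psibarS ((c : ℕ) + 1) (p + 1) k)) • x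

end WCtx

namespace WCtx

variable (C : WCtx)

/-- The joint highest weight vector `v_{μ,S} = A_1^{μ_1-μ_2} ⋯ A_n^{μ_n-μ_{n+1}} |0⟩`. -/
def vSP (μ : ℕ → ℤ) : C.F :=
  (((List.range C.n).map fun idx =>
      C.Adet (idx + 1) ^ ((μ (idx + 1) - μ (idx + 2)).toNat)).prod) • C.vac

end WCtx

section DeterminantDerivations

variable {R A : Type*} [CommRing R] [CommRing A] [Algebra R A]

/-- The Leibniz rule for a finite product, with the differentiated factor replaced in place. -/
theorem Derivation.map_prod_eq_sum_update {ι : Type*} [DecidableEq ι] (D : Derivation R A A)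
    (s : Finset ι) (f : ι → A) :
    D (∏ i ∈ s, f i) = ∑ t ∈ s, ∏ i ∈ s, Function.update f t (D (f t)) i := by
  induction s using Finset.induction_on with
  | empty => simp
  | insert a s ha ih =>
    rw [Finset.prod_insert ha, D.leibniz, ih, Finset.sum_insert ha, Finset.prod_insert ha,
      Function.update_self, add_comm, smul_eq_mul, smul_eq_mul, Finset.mul_sum]
    congr 1
    · rw [mul_comm]
      congr 1
      refine Finset.prod_congr rfl fun i hi => ?_
      rw [Function.update_of_ne (by rintro rfl; exact ha hi)]
    · refine Finset.sum_congr rfl fun t ht => ?_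
      rw [Finset.prod_insert ha, Function.update_of_ne (by rintro rfl; exact ha ht)]

/-- A derivation acts on a determinant by acting on one column at a time. -/
theorem Derivation.map_det_eq_sum_updateCol {ι : Type*} [DecidableEq ι] [Fintype ι]
    (D : Derivation R A A) (M : Matrix ι ι A) :
    D M.det = ∑ t, (M.updateCol t fun r => D (M r t)).det := by
  simp only [Matrix.det_apply, map_sum]
  rw [Finset.sum_comm]
  refine Finset.sum_congr rfl fun σ _ => ?_
  rw [← Finset.smul_sum, Units.smul_def, Units.smul_def, map_zsmul, D.map_prod_eq_sum_update]
  congr 1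
  refine Finset.sum_congr rfl fun t _ => Finset.prod_congr rfl fun i _ => ?_
  by_cases h : i = t
  · subst h; simp
  · simp [h]

/-- A derivation acts on a determinant by acting on one row at a time. -/
theorem Derivation.map_det_eq_sum_updateRow {ι : Type*} [DecidableEq ι] [Fintype ι]
    (D : Derivation R A A) (M : Matrix ι ι A) :
    D M.det = ∑ t, (M.updateRow t fun r => D (M t r)).det := by
  rw [← Matrix.det_transpose, D.map_det_eq_sum_updateCol]
  refine Finset.sum_congr rfl fun t _ => ?_
  rw [← Matrix.det_transpose, Matrix.updateCol_transpose]
  simp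

/-- A derivation acts on a product of powers of eigenvectors by the weighted sum of the
eigenvalues. -/
theorem Derivation.map_prod_pow_of_eigen {ι : Type*} (D : Derivation R A A) (s : Finset ι)
    (f : ι → A) (e : ι → ℕ) (c : ι → R) (h : ∀ i ∈ s, D (f i) = c i • f i) :
    D (∏ i ∈ s, f i ^ e i) = (∑ i ∈ s, (e i : R) * c i) • ∏ i ∈ s, f i ^ e i := by
  classical
  have hpow : ∀ i ∈ s, D (f i ^ e i) = ((e i : R) * c i) • f i ^ e i := by
    intro i hi
    rw [D.leibniz_pow, h i hi]
    rcases Nat.eq_zero_or_pos (e i) with h0 | h0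
    · simp [h0]
    · obtain ⟨k, hk⟩ : ∃ k, e i = k + 1 := ⟨e i - 1, by omega⟩
      rw [hk, Nat.add_sub_cancel, smul_comm, ← nsmul_eq_mul, smul_assoc]
      simp only [smul_eq_mul, pow_succ, mul_smul_comm]
  induction s using Finset.induction_on with
  | empty => simp
  | insert a s ha ih =>
    rw [Finset.prod_insert ha, D.leibniz, hpow a (Finset.mem_insert_self a s),
      ih (fun i hi => h i (Finset.mem_insert_of_mem hi))
        (fun i hi => hpow i (Finset.mem_insert_of_mem hi)), Finset.sum_insert ha, add_smul,
      smul_eq_mul, smul_eq_mul, mul_smul_comm, mul_smul_comm, add_comm,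
      mul_comm (∏ i ∈ s, f i ^ e i)]

theorem MvPolynomial.pderiv_comm {σ : Type*} (i j : σ) (f : MvPolynomial σ R) :
    pderiv i (pderiv j f) = pderiv j (pderiv i f) := by
  classical
  have h : ⁅(pderiv i : Derivation R (MvPolynomial σ R) (MvPolynomial σ R)),
      pderiv (R := R) j⁆ = 0 := by
    refine MvPolynomial.derivation_ext fun k => ?_
    rw [Derivation.commutator_apply, pderiv_X, pderiv_X]
    by_cases h1 : j = k <;> by_cases h2 : i = k <;> simp [h1, h2]
  have := DFunLike.congr_fun h f
  rwa [Derivation.commutator_apply, Derivation.zero_apply, sub_eq_zero] at this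

end DeterminantDerivations

section MinorPolynomials

open MvPolynomial

variable {n : ℕ}

/-- The leading `l × l` minor of the generic matrix with rows `Fin n` and columns `ℕ`
(entries in rows beyond `n` are set to zero). -/
def leadingMinor (n l : ℕ) : MvPolynomial (Fin n × ℕ) ℂ :=
  (Matrix.of fun k t : Fin l =>
    if h : (k : ℕ) < n then X ((⟨k, h⟩ : Fin n), (t : ℕ)) else 0).det

/-- The polarization operator `Σ_c x_{c,s} ∂/∂x_{c,s'}` between columns. -/
def colPolarization (s s' : ℕ) :
    Derivation ℂ (MvPolynomial (Fin n × ℕ) ℂ) (MvPolynomial (Fin n × ℕ) ℂ) :=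
  ∑ c : Fin n, (X (c, s) : MvPolynomial (Fin n × ℕ) ℂ) • pderiv (c, s')

/-- The polarization operator `Σ_{t < K} x_{p,t} ∂/∂x_{s,t}` between rows. -/
def rowPolarization (K : ℕ) (p s : Fin n) :
    Derivation ℂ (MvPolynomial (Fin n × ℕ) ℂ) (MvPolynomial (Fin n × ℕ) ℂ) :=
  ∑ t ∈ Finset.range K, (X (p, t) : MvPolynomial (Fin n × ℕ) ℂ) • pderiv (s, t)

theorem derivation_finset_sum_apply {R A ι : Type*} [CommRing R] [CommRing A] [Algebra R A]
    (s : Finset ι) (D : ι → Derivation R A A) (a : A) : (∑ i ∈ s, D i) a = ∑ i ∈ s, D i a := by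
  classical
  induction s using Finset.induction_on with
  | empty => simp
  | insert i s hi ih => rw [Finset.sum_insert hi, Finset.sum_insert hi, Derivation.add_apply, ih]

theorem colPolarization_apply (s s' : ℕ) (f : MvPolynomial (Fin n × ℕ) ℂ) :
    colPolarization s s' f = ∑ c : Fin n, X (c, s) * pderiv (c, s') f := by
  simp [colPolarization, derivation_finset_sum_apply]

theorem rowPolarization_apply (K : ℕ) (p s : Fin n) (f : MvPolynomial (Fin n × ℕ) ℂ) :
    rowPolarization K p s f = ∑ t ∈ Finset.range K, X (p, t) * pderiv (s, t) f := by
  simp [rowPolarization, derivation_finset_sum_apply]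

theorem colPolarization_X (s s' : ℕ) (c : Fin n) (t : ℕ) :
    colPolarization s s' (X (c, t)) = if t = s' then X (c, s) else 0 := by
  rw [colPolarization_apply, Finset.sum_eq_single c]
  · by_cases h : t = s' <;> simp [pderiv_X, h]
  · intro b _ hb
    simp [pderiv_X, Ne.symm hb]
  · simp

theorem rowPolarization_X (K : ℕ) (p s c : Fin n) (t : ℕ) :
    rowPolarization K p s (X (c, t)) = if c = s ∧ t < K then X (p, t) else 0 := by
  rw [rowPolarization_apply]
  by_cases hc : c = s
  · subst hc
    by_cases ht : t < K
    · rw [Finset.sum_eq_single t]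
      · simp [ht]
      · intro b _ hb
        simp [pderiv_X, Ne.symm hb]
      · simp [ht]
    · rw [Finset.sum_eq_zero]
      · simp [ht]
      · intro b hb
        have : t ≠ b := by rintro rfl; exact ht (Finset.mem_range.1 hb)
        simp [pderiv_X, this]
  · simp [pderiv_X, hc]

theorem colPolarization_leadingMinor_of_lt {s s' : ℕ} (h : s < s') (l : ℕ) :
    colPolarization s s' (leadingMinor n l) = 0 := by
  rw [leadingMinor, Derivation.map_det_eq_sum_updateCol]
  refine Finset.sum_eq_zero fun t _ => ?_
  by_cases ht : (t : ℕ) = s'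
  · have hs : s < l := by omega
    have hne : (⟨s, hs⟩ : Fin l) ≠ t := by
      intro h'; rw [← h'] at ht; simp at ht; omega
    refine Matrix.det_zero_of_column_eq hne fun k => ?_
    rw [Matrix.updateCol_ne hne, Matrix.updateCol_self]
    by_cases hk : (k : ℕ) < n
    · simp [hk, colPolarization_X, ht]
    · simp [hk]
  · refine Matrix.det_eq_zero_of_column_eq_zero t fun k => ?_
    rw [Matrix.updateCol_self]
    by_cases hk : (k : ℕ) < n
    · simp [hk, colPolarization_X, ht]
    · simp [hk]

theorem colPolarization_leadingMinor_self (s l : ℕ) :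
    colPolarization s s (leadingMinor n l)
      = (if s < l then (1 : ℂ) else 0) • leadingMinor n l := by
  rw [leadingMinor, Derivation.map_det_eq_sum_updateCol]
  have hz : ∀ t : Fin l, (t : ℕ) ≠ s →
      ((Matrix.of fun k t : Fin l =>
        if h : (k : ℕ) < n then (X ((⟨k, h⟩ : Fin n), (t : ℕ)) : MvPolynomial (Fin n × ℕ) ℂ)
        else 0).updateCol t fun r => colPolarization s s ((Matrix.of fun k t : Fin l =>
        if h : (k : ℕ) < n then (X ((⟨k, h⟩ : Fin n), (t : ℕ)) : MvPolynomial (Fin n × ℕ) ℂ)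
        else 0) r t)).det = 0 := by
    intro t ht
    refine Matrix.det_eq_zero_of_column_eq_zero t fun k => ?_
    rw [Matrix.updateCol_self]
    by_cases hk : (k : ℕ) < n
    · simp [hk, colPolarization_X, ht]
    · simp [hk]
  by_cases hs : s < l
  · rw [Finset.sum_eq_single (⟨s, hs⟩ : Fin l) (fun t _ ht => hz t fun h => ht (Fin.ext h))
      (by simp), if_pos hs, one_smul]
    congr 1
    ext1 k t
    rw [Matrix.updateCol_apply]
    split_ifs with ht
    · subst ht
      by_cases hk : (k : ℕ) < n
      · simp [hk, colPolarization_X]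
      · simp [hk]
    · rfl
  · rw [Finset.sum_eq_zero fun t _ => hz t (by omega), if_neg hs, zero_smul]

theorem rowPolarization_leadingMinor_of_lt (K : ℕ) {p s : Fin n} (h : p < s) {l : ℕ}
    (hK : l ≤ K) : rowPolarization K p s (leadingMinor n l) = 0 := by
  rw [leadingMinor, Derivation.map_det_eq_sum_updateRow]
  refine Finset.sum_eq_zero fun t _ => ?_
  by_cases ht : (t : ℕ) = s
  · have hp : (p : ℕ) < l := by
      have : (p : ℕ) < s := h
      omega
    have hne : (⟨p, hp⟩ : Fin l) ≠ t := by
      intro h'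
      have : (p : ℕ) < s := h
      rw [← h'] at ht; simp at ht; omega
    refine Matrix.det_zero_of_row_eq hne (funext fun k => ?_)
    rw [Matrix.updateRow_ne hne, Matrix.updateRow_self]
    have hk : (k : ℕ) < K := by omega
    simp [rowPolarization_X, ht, hk]
  · refine Matrix.det_eq_zero_of_row_eq_zero t fun k => ?_
    rw [Matrix.updateRow_self]
    by_cases hk : (t : ℕ) < n
    · simp [hk, rowPolarization_X, Fin.ext_iff, ht]
    · simp [hk]

theorem rowPolarization_leadingMinor_self (K : ℕ) (p : Fin n) {l : ℕ} (hK : l ≤ K) :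
    rowPolarization K p p (leadingMinor n l)
      = (if (p : ℕ) < l then (1 : ℂ) else 0) • leadingMinor n l := by
  rw [leadingMinor, Derivation.map_det_eq_sum_updateRow]
  have hz : ∀ t : Fin l, (t : ℕ) ≠ p →
      ((Matrix.of fun k t : Fin l =>
        if h : (k : ℕ) < n then (X ((⟨k, h⟩ : Fin n), (t : ℕ)) : MvPolynomial (Fin n × ℕ) ℂ)
        else 0).updateRow t fun r => rowPolarization K p p ((Matrix.of fun k t : Fin l =>
        if h : (k : ℕ) < n then (X ((⟨k, h⟩ : Fin n), (t : ℕ)) : MvPolynomial (Fin n × ℕ) ℂ)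
        else 0) t r)).det = 0 := by
    intro t ht
    refine Matrix.det_eq_zero_of_row_eq_zero t fun k => ?_
    rw [Matrix.updateRow_self]
    by_cases hk : (t : ℕ) < n
    · simp [hk, rowPolarization_X, Fin.ext_iff, ht]
    · simp [hk]
  by_cases hs : (p : ℕ) < l
  · rw [Finset.sum_eq_single (⟨p, hs⟩ : Fin l) (fun t _ ht => hz t fun h => ht (Fin.ext h))
      (by simp), if_pos hs, one_smul]
    congr 1
    ext1 k t
    rw [Matrix.updateRow_apply]
    split_ifs with hk
    · subst hk
      have ht : (t : ℕ) < K := by omega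
      simp [rowPolarization_X, ht]
    · rfl
  · rw [Finset.sum_eq_zero fun t _ => hz t (by omega), if_neg hs, zero_smul]

theorem eval_leadingMinor {l : ℕ} (hl : l ≤ n) :
    eval (fun p : Fin n × ℕ => if (p.1 : ℕ) = p.2 then (1 : ℂ) else 0) (leadingMinor n l) = 1 := by
  rw [leadingMinor, RingHom.map_det, ← Matrix.det_one (n := Fin l)]
  congr 1
  ext k t
  have hk : (k : ℕ) < n := by omega
  simp [hk, Matrix.one_apply, Fin.ext_iff]

/-- The product of powers of leading minors `∏_{l=1}^{n} Δ_l^{e_{l-1}}`. -/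
def minorProduct (n : ℕ) (e : ℕ → ℕ) : MvPolynomial (Fin n × ℕ) ℂ :=
  ∏ l ∈ Finset.range n, leadingMinor n (l + 1) ^ e l

theorem eval_minorProduct (e : ℕ → ℕ) :
    eval (fun p : Fin n × ℕ => if (p.1 : ℕ) = p.2 then (1 : ℂ) else 0) (minorProduct n e) = 1 := by
  rw [minorProduct, map_prod]
  refine Finset.prod_eq_one fun l hl => ?_
  rw [map_pow, eval_leadingMinor (by simpa using hl), one_pow]

theorem colPolarization_minorProduct_of_lt {s s' : ℕ} (h : s < s') (e : ℕ → ℕ) :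
    colPolarization s s' (minorProduct n e) = 0 := by
  rw [minorProduct, Derivation.map_prod_pow_of_eigen _ _ _ _ (fun _ => (0 : ℂ))]
  · simp
  · intro l _
    rw [colPolarization_leadingMinor_of_lt h, zero_smul]

theorem colPolarization_minorProduct_self (s : ℕ) (e : ℕ → ℕ) :
    colPolarization s s (minorProduct n e)
      = (∑ l ∈ Finset.range n, (e l : ℂ) * if s < l + 1 then 1 else 0) • minorProduct n e := by
  rw [minorProduct, Derivation.map_prod_pow_of_eigen]
  intro l _
  exact colPolarization_leadingMinor_self s (l + 1)

theorem rowPolarization_minorProduct_of_lt {K : ℕ} (hK : n ≤ K) {p s : Fin n} (h : p < s)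
    (e : ℕ → ℕ) : rowPolarization K p s (minorProduct n e) = 0 := by
  rw [minorProduct, Derivation.map_prod_pow_of_eigen _ _ _ _ (fun _ => (0 : ℂ))]
  · simp
  · intro l hl
    rw [Finset.mem_range] at hl
    rw [rowPolarization_leadingMinor_of_lt K h (by omega), zero_smul]

theorem rowPolarization_minorProduct_self {K : ℕ} (hK : n ≤ K) (p : Fin n) (e : ℕ → ℕ) :
    rowPolarization K p p (minorProduct n e)
      = (∑ l ∈ Finset.range n, (e l : ℂ) * if (p : ℕ) < l + 1 then 1 else 0)
        • minorProduct n e := by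
  rw [minorProduct, Derivation.map_prod_pow_of_eigen]
  intro l hl
  rw [Finset.mem_range] at hl
  exact rowPolarization_leadingMinor_self K p (by omega)

theorem pderiv_minorProduct_of_le (c : Fin n) {t : ℕ} (ht : n ≤ t) (e : ℕ → ℕ) :
    pderiv (c, t) (minorProduct n e) = 0 := by
  rw [minorProduct, Derivation.map_prod_pow_of_eigen _ _ _ _ (fun _ => (0 : ℂ))]
  · simp
  · intro l hl
    rw [Finset.mem_range] at hl
    rw [zero_smul, leadingMinor, Derivation.map_det_eq_sum_updateCol]
    refine Finset.sum_eq_zero fun i _ => Matrix.det_eq_zero_of_column_eq_zero i fun k => ?_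
    have hk : (k : ℕ) < n := by omega
    have hi : (i : ℕ) ≠ t := by omega
    simp [hk, pderiv_X, hi]

end MinorPolynomials

namespace WCtx

open MvPolynomial

variable (C : WCtx)

/-! ### The polynomial representation, used to show that highest weight vectors are nonzero -/

/-- The action of a generator on polynomials: negative modes multiply, nonnegative modes
differentiate. -/
def polyGen : C.Gen → Module.End ℂ (MvPolynomial C.Gen ℂ)
  | (Sum.inl i, k) =>
    if k < 0 then LinearMap.mulLeft ℂ (X (Sum.inl i, k))
    else -(pderiv (Sum.inr i, -k - 1) : Derivation ℂ (MvPolynomial C.Gen ℂ) _).toLinearMap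
  | (Sum.inr i, k) =>
    if k < 0 then LinearMap.mulLeft ℂ (X (Sum.inr i, k))
    else (pderiv (Sum.inl i, -k - 1) : Derivation ℂ (MvPolynomial C.Gen ℂ) _).toLinearMap

theorem lift_polyGen_rel (hS : C.sig = 1) ⦃x y : FreeAlgebra ℂ C.Gen⦄ (h : C.rel x y) :
    FreeAlgebra.lift ℂ C.polyGen x = FreeAlgebra.lift ℂ C.polyGen y := by
  induction h with
  | comm_psi i j k l =>
    simp only [map_mul, FreeAlgebra.lift_ι_apply, polyGen]
    refine LinearMap.ext fun f => ?_
    by_cases hk : k < 0 <;> by_cases hl : l < 0 <;> simp [hk, hl, pderiv_X]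
    · ring
    · exact pderiv_comm _ _ _
  | comm_psibar i j k l =>
    simp only [map_mul, FreeAlgebra.lift_ι_apply, polyGen]
    refine LinearMap.ext fun f => ?_
    by_cases hk : k < 0 <;> by_cases hl : l < 0 <;> simp [hk, hl, pderiv_X]
    · ring
    · exact pderiv_comm _ _ _
  | mixed i j k l =>
    have key : ∀ (p : Prop) [Decidable p], FreeAlgebra.lift ℂ C.polyGen (if p then 1 else 0)
        = if p then 1 else 0 := by
      intro p _
      split_ifs <;> simp
    simp only [map_mul, map_add, FreeAlgebra.lift_ι_apply, polyGen, key, hS]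
    refine LinearMap.ext fun f => ?_
    by_cases hk : k < 0 <;> by_cases hl : l < 0
    · have hn : ¬ (i = j ∧ k + l + 1 = 0) := by omega
      simp [hk, hl, hn]
      ring
    · by_cases hij : i = j ∧ k + l + 1 = 0
      · obtain ⟨rfl, h0⟩ := hij
        obtain rfl : k = -l - 1 := by omega
        rw [if_pos (show i = i ∧ -l - 1 + l + 1 = 0 from ⟨rfl, h0⟩)]
        simp [hk, hl, pderiv_X]
      · have hne : ¬ ((Sum.inr i, k) : C.Gen) = (Sum.inr j, -l - 1) := by
          intro h
          simp only [Prod.mk.injEq, Sum.inr.injEq] at h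
          exact hij ⟨h.1, by omega⟩
        simp [hk, hl, hij, pderiv_X, hne]
    · by_cases hij : i = j ∧ k + l + 1 = 0
      · obtain ⟨rfl, h0⟩ := hij
        obtain rfl : l = -k - 1 := by omega
        rw [if_pos (show i = i ∧ k + (-k - 1) + 1 = 0 from ⟨rfl, h0⟩)]
        simp [hk, hl, pderiv_X]
      · have hne : ¬ ((Sum.inl j, l) : C.Gen) = (Sum.inl i, -k - 1) := by
          intro h
          simp only [Prod.mk.injEq, Sum.inl.injEq] at h
          exact hij ⟨h.1.symm, by omega⟩
        simp [hk, hl, hij, pderiv_X, hne]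
    · have hn : ¬ (i = j ∧ k + l + 1 = 0) := by omega
      simp [hk, hl, hn]
      exact pderiv_comm _ _ _

/-- The polynomial representation of `W_N(ℤ + 1/2)`. -/
def polyRep (hS : C.sig = 1) : C.W →ₐ[ℂ] Module.End ℂ (MvPolynomial C.Gen ℂ) :=
  RingQuot.liftAlgHom ℂ ⟨FreeAlgebra.lift ℂ C.polyGen, C.lift_polyGen_rel hS⟩

theorem polyRep_psi0 (hS : C.sig = 1) (i : Fin C.NN) (k : ℤ) :
    C.polyRep hS (C.psi0 i k) = C.polyGen (Sum.inl i, k) := by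
  rw [polyRep, psi0]
  erw [RingQuot.liftAlgHom_mkAlgHom_apply]
  rw [FreeAlgebra.lift_ι_apply]

theorem polyRep_psibar0 (hS : C.sig = 1) (i : Fin C.NN) (k : ℤ) :
    C.polyRep hS (C.psibar0 i k) = C.polyGen (Sum.inr i, k) := by
  rw [polyRep, psibar0]
  erw [RingQuot.liftAlgHom_mkAlgHom_apply]
  rw [FreeAlgebra.lift_ι_apply]

theorem polyRep_one_eq_zero (hS : C.sig = 1) {w : C.W} (hw : w ∈ C.vacIdeal) :
    C.polyRep hS w 1 = 0 := by
  induction hw using Submodule.span_induction with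
  | mem w h =>
    rcases h with ⟨i, k, hk, rfl | rfl⟩ | ⟨h0, -⟩
    · have : ¬ k < 0 := by omega
      simp [polyRep_psi0, polyGen, this]
    · have : ¬ k < 0 := by omega
      simp [polyRep_psibar0, polyGen, this]
    · omega
  | zero => simp
  | add x y _ _ hx hy => simp [hx, hy]
  | smul a x _ hx => simp [hx]

/-! ### Relations in the Weyl algebra and its Fock module -/

theorem psi0_comm (i j : Fin C.NN) (k l : ℤ) :
    C.psi0 i k * C.psi0 j l = C.psi0 j l * C.psi0 i k := by
  have := RingQuot.mkAlgHom_rel ℂ (rel.comm_psi (C := C) i j k l)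
  rw [map_mul, map_mul] at this
  exact this

theorem psibar0_mul_psi0 (hS : C.sig = 1) (i j : Fin C.NN) (k l : ℤ) :
    C.psibar0 i k * C.psi0 j l
      = C.psi0 j l * C.psibar0 i k + if i = j ∧ k + l + 1 = 0 then 1 else 0 := by
  have := RingQuot.mkAlgHom_rel ℂ (rel.mixed (C := C) i j k l)
  rw [map_mul, map_add, map_mul, apply_ite (RingQuot.mkAlgHom ℂ C.rel), map_one, map_zero,
    hS] at this
  exact this

theorem smul_vac_eq_mk (w : C.W) : w • C.vac = Submodule.Quotient.mk (p := C.vacIdeal) w := by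
  change Submodule.Quotient.mk (p := C.vacIdeal) (w * 1) = _
  rw [mul_one]

theorem psi0_smul_vac (hS : C.sig = 1) (i : Fin C.NN) {k : ℤ} (hk : 0 ≤ k) :
    C.psi0 i k • C.vac = 0 := by
  rw [smul_vac_eq_mk]
  exact (Submodule.Quotient.mk_eq_zero _).2
    (Submodule.subset_span (Or.inl ⟨i, k, by omega, Or.inl rfl⟩))

theorem psibar0_smul_vac (hS : C.sig = 1) (i : Fin C.NN) {k : ℤ} (hk : 0 ≤ k) :
    C.psibar0 i k • C.vac = 0 := by
  rw [smul_vac_eq_mk]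
  exact (Submodule.Quotient.mk_eq_zero _).2
    (Submodule.subset_span (Or.inl ⟨i, k, by omega, Or.inr rfl⟩))

instance : IsScalarTower ℂ C.W C.F :=
  inferInstanceAs (IsScalarTower ℂ C.W (C.W ⧸ C.vacIdeal))

/-- The flat (0-based) index of column residue `s mod m` in block `c`. -/
def flatIdx (c : Fin C.n) (s : ℕ) : Fin C.NN :=
  ⟨s % C.m + c * C.m, by
    have h1 := Nat.mod_lt s C.hm
    have h2 : ((c : ℕ) + 1) * C.m ≤ C.n * C.m := Nat.mul_le_mul_right _ c.2
    rw [NN, mul_comm C.m C.n]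
    linarith⟩

theorem flatIdx_div (c : Fin C.n) (s : ℕ) : (C.flatIdx c s : ℕ) / C.m = c := by
  simp only [flatIdx]
  rw [Nat.add_mul_div_right _ _ C.hm, Nat.div_eq_of_lt (Nat.mod_lt s C.hm), zero_add]

theorem flatIdx_mod (c : Fin C.n) (s : ℕ) : (C.flatIdx c s : ℕ) % C.m = s % C.m := by
  simp only [flatIdx]
  rw [Nat.add_mul_mod_self_right, Nat.mod_mod]

/-- The creation operator `ψ_{s mod m + 1}^{c+1}(-⌊s/m⌋ - 1/2)`. -/
def creation (p : Fin C.n × ℕ) : C.W := C.psi0 (C.flatIdx p.1 p.2) (-((p.2 / C.m : ℕ) : ℤ) - 1)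

/-- The annihilation operator `ψ̄_{s mod m + 1}^{c+1}(⌊s/m⌋ + 1/2)`. -/
def annihilation (p : Fin C.n × ℕ) : C.W := C.psibar0 (C.flatIdx p.1 p.2) ((p.2 / C.m : ℕ) : ℤ)

theorem annihilation_mul_creation (hS : C.sig = 1) (p p' : Fin C.n × ℕ) :
    C.annihilation p * C.creation p'
      = C.creation p' * C.annihilation p + if p = p' then 1 else 0 := by
  rw [annihilation, creation, psibar0_mul_psi0 C hS]
  congr 1
  refine if_congr ⟨fun h => ?_, ?_⟩ rfl rfl
  · obtain ⟨h1, h2⟩ := h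
    have hd := congrArg (fun i : Fin C.NN => (i : ℕ) / C.m) h1
    have hm := congrArg (fun i : Fin C.NN => (i : ℕ) % C.m) h1
    simp only [flatIdx_div, flatIdx_mod] at hd hm
    have hq : p.2 / C.m = p'.2 / C.m := by omega
    refine Prod.ext (Fin.ext hd) ?_
    rw [← Nat.div_add_mod p.2 C.m, ← Nat.div_add_mod p'.2 C.m, hm, hq]
  · rintro rfl
    exact ⟨rfl, by ring⟩

open scoped IsMulCommutative in
theorem exists_creationHom : ∃ Θ : MvPolynomial (Fin C.n × ℕ) ℂ →ₐ[ℂ] C.W,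
    ∀ p, Θ (X p) = C.creation p := by
  have : IsMulCommutative (Algebra.adjoin ℂ (Set.range C.creation)) :=
    Algebra.isMulCommutative_adjoin ℂ (by
      rintro _ ⟨p, rfl⟩ _ ⟨p', rfl⟩
      exact C.psi0_comm _ _ _ _)
  refine ⟨(Algebra.adjoin ℂ (Set.range C.creation)).val.comp
    (aeval fun p : Fin C.n × ℕ => ⟨C.creation p, Algebra.subset_adjoin ⟨p, rfl⟩⟩), fun p => ?_⟩
  simp

/-- The algebra map sending polynomial variables to creation operators. -/
def creationHom : MvPolynomial (Fin C.n × ℕ) ℂ →ₐ[ℂ] C.W := C.exists_creationHom.choose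

theorem creationHom_X (p : Fin C.n × ℕ) : C.creationHom (X p) = C.creation p :=
  C.exists_creationHom.choose_spec p

theorem annihilation_mul_creationHom (hS : C.sig = 1) (p : Fin C.n × ℕ)
    (f : MvPolynomial (Fin C.n × ℕ) ℂ) :
    C.annihilation p * C.creationHom f
      = C.creationHom f * C.annihilation p + C.creationHom (pderiv p f) := by
  induction f using MvPolynomial.induction_on with
  | C a =>
    rw [pderiv_C, map_zero, add_zero, ← MvPolynomial.algebraMap_eq, AlgHom.commutes]
    exact (Algebra.commutes _ _).symm
  | add f g hf hg => rw [map_add, mul_add, add_mul, hf, hg, map_add, map_add]; abel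
  | mul_X f p' hf =>
    rw [map_mul, ← mul_assoc, hf, pderiv_mul, map_add, map_mul, map_mul, creationHom_X, add_mul,
      mul_assoc, annihilation_mul_creation C hS, pderiv_X, mul_add, ← mul_assoc]
    by_cases h : p = p'
    · subst h; simp only [if_true, Pi.single_eq_same, map_one, mul_one]; abel
    · rw [if_neg h, Pi.single_eq_of_ne (Ne.symm h), map_zero, mul_zero]; abel

theorem psi0_mul_creationHom (i : Fin C.NN) (k : ℤ) (f : MvPolynomial (Fin C.n × ℕ) ℂ) :
    C.psi0 i k * C.creationHom f = C.creationHom f * C.psi0 i k := by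
  induction f using MvPolynomial.induction_on with
  | C a =>
    rw [← MvPolynomial.algebraMap_eq, AlgHom.commutes]
    exact (Algebra.commutes _ _).symm
  | add f g hf hg => rw [map_add, mul_add, add_mul, hf, hg]
  | mul_X f p' hf =>
    rw [map_mul, ← mul_assoc, hf, mul_assoc, creationHom_X, creation, C.psi0_comm, mul_assoc]

/-- The Fock space vector obtained by applying a polynomial in creation operators to the
vacuum. -/
def fockVec : MvPolynomial (Fin C.n × ℕ) ℂ →ₗ[ℂ] C.F where
  toFun f := C.creationHom f • C.vac
  map_add' f g := by rw [map_add, add_smul]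
  map_smul' a f := by rw [map_smul, smul_assoc, RingHom.id_apply]

theorem fockVec_apply (f : MvPolynomial (Fin C.n × ℕ) ℂ) :
    C.fockVec f = C.creationHom f • C.vac := rfl

theorem psi0_smul_fockVec (hS : C.sig = 1) (i : Fin C.NN) {k : ℤ} (hk : 0 ≤ k)
    (f : MvPolynomial (Fin C.n × ℕ) ℂ) : C.psi0 i k • C.fockVec f = 0 := by
  rw [fockVec_apply, ← mul_smul, psi0_mul_creationHom, mul_smul, psi0_smul_vac C hS i hk, smul_zero]

theorem creation_smul_fockVec (p : Fin C.n × ℕ) (f : MvPolynomial (Fin C.n × ℕ) ℂ) :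
    C.creation p • C.fockVec f = C.fockVec (X p * f) := by
  rw [fockVec_apply, fockVec_apply, map_mul, creationHom_X, mul_smul]

theorem annihilation_smul_fockVec (hS : C.sig = 1) (p : Fin C.n × ℕ)
    (f : MvPolynomial (Fin C.n × ℕ) ℂ) :
    C.annihilation p • C.fockVec f = C.fockVec (pderiv p f) := by
  rw [fockVec_apply, fockVec_apply, ← mul_smul, annihilation_mul_creationHom C hS, add_smul,
    mul_smul, annihilation, psibar0_smul_vac C hS _ (Int.natCast_nonneg _), smul_zero, zero_add]

theorem polyRep_creationHom (hS : C.sig = 1) (f : MvPolynomial (Fin C.n × ℕ) ℂ)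
    (g : MvPolynomial C.Gen ℂ) :
    C.polyRep hS (C.creationHom f) g = aeval (fun p : Fin C.n × ℕ =>
      (X (Sum.inl (C.flatIdx p.1 p.2), -((p.2 / C.m : ℕ) : ℤ) - 1) : MvPolynomial C.Gen ℂ)) f
        * g := by
  induction f using MvPolynomial.induction_on generalizing g with
  | C a =>
    rw [← MvPolynomial.algebraMap_eq, AlgHom.commutes, AlgHom.commutes, AlgHom.commutes,
      Module.algebraMap_end_apply, Algebra.smul_def]
  | add f f' hf hf' => simp [hf, hf', add_mul]
  | mul_X f p hf =>
    have hneg : -((p.2 / C.m : ℕ) : ℤ) - 1 < 0 := by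
      have := Int.natCast_nonneg (p.2 / C.m)
      omega
    rw [map_mul, map_mul, Module.End.mul_apply, creationHom_X, creation, polyRep_psi0, polyGen,
      if_pos hneg, LinearMap.mulLeft_apply, hf, map_mul, aeval_X, mul_assoc]

theorem fockVec_ne_zero (hS : C.sig = 1) {f : MvPolynomial (Fin C.n × ℕ) ℂ}
    (hf : eval (fun p : Fin C.n × ℕ => if (p.1 : ℕ) = p.2 then (1 : ℂ) else 0) f ≠ 0) :
    C.fockVec f ≠ 0 := by
  intro h
  rw [fockVec_apply, smul_vac_eq_mk] at h
  have h1 := C.polyRep_one_eq_zero hS ((Submodule.Quotient.mk_eq_zero _).1 h)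
  rw [polyRep_creationHom, mul_one] at h1
  apply hf
  have h2 := congrArg (eval fun g : C.Gen => match g with
    | (Sum.inl i, k) => if (i : ℕ) / C.m = (i : ℕ) % C.m + C.m * (-k - 1).toNat then (1 : ℂ) else 0
    | (Sum.inr _, _) => 0) h1
  rw [map_zero] at h2
  refine Eq.trans ?_ h2
  rw [← MvPolynomial.coe_aeval_eq_eval, ← MvPolynomial.coe_aeval_eq_eval]
  change _ = ((aeval _).comp (aeval _)) f
  rw [MvPolynomial.comp_aeval]
  change aeval _ f = aeval _ f
  congr 2
  ext p
  have ht : (-(-((p.2 / C.m : ℕ) : ℤ) - 1) - 1).toNat = p.2 / C.m := by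
    rw [show -(-((p.2 / C.m : ℕ) : ℤ) - 1) - 1 = ((p.2 / C.m : ℕ) : ℤ) by ring, Int.toNat_natCast]
  simp only [aeval_X, flatIdx_div, flatIdx_mod, ht, Nat.mod_add_div]


/-! ### Quadratic operators on Fock vectors -/

theorem psiS_eq_psi0 {i : ℕ} (hi : i < C.m) (c : Fin C.n) (k : ℤ) :
    C.psiS (i + 1) ((c : ℕ) + 1) k = C.psi0 (C.flatIdx c i) k := by
  have hlt := (C.flatIdx c i).2
  simp only [flatIdx, Nat.mod_eq_of_lt hi] at hlt
  rw [psiS, psiF, Nat.add_sub_cancel, dif_pos (by omega)]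
  congr 1
  ext
  simp only [flatIdx, Nat.mod_eq_of_lt hi]
  omega

theorem psibarS_eq_psibar0 {i : ℕ} (hi : i < C.m) (c : Fin C.n) (k : ℤ) :
    C.psibarS (i + 1) ((c : ℕ) + 1) k = C.psibar0 (C.flatIdx c i) k := by
  have hlt := (C.flatIdx c i).2
  simp only [flatIdx, Nat.mod_eq_of_lt hi] at hlt
  rw [psibarS, psibarF, Nat.add_sub_cancel, dif_pos (by omega)]
  congr 1
  ext
  simp only [flatIdx, Nat.mod_eq_of_lt hi]
  omega

theorem flatIdx_add_mul (c : Fin C.n) (i k : ℕ) :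
    C.flatIdx c (i + C.m * k) = C.flatIdx c i := by
  ext
  simp only [flatIdx, Nat.add_mul_mod_self_left]

theorem psiS_eq_creation {i : ℕ} (hi : i < C.m) (c : Fin C.n) {k : ℤ} (hk : k < 0) :
    C.psiS (i + 1) ((c : ℕ) + 1) k = C.creation (c, i + C.m * (-k - 1).toNat) := by
  rw [psiS_eq_psi0 C hi, creation, flatIdx_add_mul]
  congr 1
  simp only [Nat.add_mul_div_left _ _ C.hm, Nat.div_eq_of_lt hi]
  omega

theorem psibarS_eq_annihilation {i : ℕ} (hi : i < C.m) (c : Fin C.n) {k : ℤ} (hk : 0 ≤ k) :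
    C.psibarS (i + 1) ((c : ℕ) + 1) k = C.annihilation (c, i + C.m * k.toNat) := by
  rw [psibarS_eq_psibar0 C hi, annihilation, flatIdx_add_mul]
  congr 1
  simp only [Nat.add_mul_div_left _ _ C.hm, Nat.div_eq_of_lt hi]
  omega

theorem nord_psi_psibar_smul_fockVec (hS : C.sig = 1) {i j : ℕ} (hi : i < C.m) (hj : j < C.m)
    (c c' : Fin C.n) {a : ℤ} (ha : 0 ≤ a) (k : ℤ) (f : MvPolynomial (Fin C.n × ℕ) ℂ) :
    C.nord (C.psiS (i + 1) ((c : ℕ) + 1) (a - k - C.sig)) k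
        (C.psibarS (j + 1) ((c' : ℕ) + 1) k) • C.fockVec f
      = if a ≤ k then C.fockVec
          (X (c, i + C.m * (k - a).toNat) * pderiv (c', j + C.m * k.toNat) f) else 0 := by
  rw [nord, hS]
  rcases lt_or_ge k 0 with hk | hk
  · rw [if_neg (by omega), if_neg (by omega), if_neg (by omega), mul_smul, psiS_eq_psi0 C hi,
      psi0_smul_fockVec C hS _ (by omega), smul_zero]
  · rw [if_pos (by omega), mul_smul, psibarS_eq_annihilation C hj _ hk,
      annihilation_smul_fockVec C hS]
    split_ifs with hak
    · rw [psiS_eq_creation C hi _ (by omega), creation_smul_fockVec,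
        show -(a - k - 1) - 1 = k - a by ring]
    · rw [psiS_eq_psi0 C hi, psi0_smul_fockVec C hS _ (by omega)]

theorem nord_psi_psi_smul_fockVec (hS : C.sig = 1) {i j : ℕ} (hi : i < C.m) (hj : j < C.m)
    (c c' : Fin C.n) (k : ℤ) (f : MvPolynomial (Fin C.n × ℕ) ℂ) :
    C.nord (C.psiS (i + 1) ((c : ℕ) + 1) (-k - C.sig)) k
        (C.psiS (j + 1) ((c' : ℕ) + 1) k) • C.fockVec f = 0 := by
  rw [nord, hS, psiS_eq_psi0 C hi, psiS_eq_psi0 C hj]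
  rcases lt_or_ge k 0 with hk | hk
  · rw [if_neg (by omega), if_neg (by omega), mul_smul, psi0_smul_fockVec C hS _ (by omega),
      smul_zero]
  · rw [if_pos (by omega), mul_smul, psi0_smul_fockVec C hS _ hk, smul_zero]

theorem sum_nord_psi_psibar_smul_fockVec (hS : C.sig = 1) {i j : ℕ} (hi : i < C.m) (hj : j < C.m)
    {a : ℤ} (ha : 0 ≤ a) (k : ℤ) (f : MvPolynomial (Fin C.n × ℕ) ℂ) :
    ∑ c : Fin C.n, C.nord (C.psiS (i + 1) ((c : ℕ) + 1) (a - k - C.sig)) k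
        (C.psibarS (j + 1) ((c : ℕ) + 1) k) • C.fockVec f
      = if a ≤ k then C.fockVec
          (colPolarization (i + C.m * (k - a).toNat) (j + C.m * k.toNat) f) else 0 := by
  simp only [nord_psi_psibar_smul_fockVec C hS hi hj _ _ ha]
  split_ifs
  · rw [colPolarization_apply, map_sum]
  · exact Finset.sum_const_zero

theorem sum_range_mul_eq {M : Type*} [AddCommMonoid M] (m n : ℕ) (g : ℕ → M) :
    ∑ t ∈ Finset.range (n * m), g t = ∑ k ∈ Finset.range n, ∑ c : Fin m, g (c + m * k) := by
  rw [Finset.sum_range, Finset.sum_range, ← Fintype.sum_prod_type', ← finProdFinEquiv.sum_comp]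
  rfl

theorem finsum_rowOperator_smul_fockVec (hS : C.sig = 1) (p s : Fin C.n) (e : ℕ → ℕ) :
    (∑ᶠ k : ℤ, (∑ c : Fin C.m, C.nord (C.psiS ((c : ℕ) + 1) ((p : ℕ) + 1) (-k - C.sig)) k
        (C.psibarS ((c : ℕ) + 1) ((s : ℕ) + 1) k)) • C.fockVec (minorProduct C.n e))
      = C.fockVec (rowPolarization (C.n * C.m) p s (minorProduct C.n e)) := by
  have hterm : ∀ k : ℤ, (∑ c : Fin C.m,
      C.nord (C.psiS ((c : ℕ) + 1) ((p : ℕ) + 1) (-k - C.sig)) k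
        (C.psibarS ((c : ℕ) + 1) ((s : ℕ) + 1) k)) • C.fockVec (minorProduct C.n e)
      = if 0 ≤ k then ∑ c : Fin C.m, C.fockVec (X (p, (c : ℕ) + C.m * k.toNat)
          * pderiv (s, (c : ℕ) + C.m * k.toNat) (minorProduct C.n e)) else 0 := by
    intro k
    rw [Finset.sum_smul]
    have h := fun c : Fin C.m =>
      C.nord_psi_psibar_smul_fockVec hS c.2 c.2 p s (le_refl 0) k (minorProduct C.n e)
    simp only [zero_sub, sub_zero] at h
    rw [Finset.sum_congr rfl fun c _ => h c]
    split_ifs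
    · rfl
    · exact Finset.sum_const_zero
  simp only [hterm]
  rw [finsum_eq_sum_of_support_subset (s := (Finset.range C.n).map Nat.castEmbedding),
    Finset.sum_map, rowPolarization_apply, sum_range_mul_eq, map_sum]
  · refine Finset.sum_congr rfl fun k _ => ?_
    simp [map_sum]
  · intro k hk
    rw [Function.mem_support] at hk
    have h0 : 0 ≤ k := by
      by_contra h
      exact hk (if_neg h)
    rw [if_pos h0] at hk
    have hlt : k.toNat < C.n := by
      by_contra h
      refine hk (Finset.sum_eq_zero fun c _ => ?_)
      have hle : C.n ≤ (c : ℕ) + C.m * k.toNat := by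
        have := Nat.le_mul_of_pos_left k.toNat C.hm
        omega
      rw [pderiv_minorProduct_of_le s hle, mul_zero, map_zero]
    simp only [Finset.coe_map, Set.mem_image, Finset.mem_coe, Finset.mem_range]
    exact ⟨k.toNat, hlt, Int.toNat_of_nonneg h0⟩

/-! ### The highest weight vector -/

theorem PhiW_eq_creation (hS : C.sig = 1) (c : Fin C.n) (t : ℕ) :
    C.PhiW ((c : ℕ) + 1) (-((t : ℤ) + 1)) = C.creation (c, t) := by
  have hm : (C.m : ℤ) ≠ 0 := by exact_mod_cast C.hm.ne'
  have h1 : (-(-((t : ℤ) + 1)) - 1).emod C.m = ((t % C.m : ℕ) : ℤ) := by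
    rw [show -(-((t : ℤ) + 1)) - 1 = t by ring]
    rfl
  have h2 : (-((t : ℤ) + 1) + ((t % C.m : ℕ) : ℤ) + 1) / C.m = -((t / C.m : ℕ) : ℤ) := by
    have h : (t : ℤ) = C.m * ((t / C.m : ℕ) : ℤ) + ((t % C.m : ℕ) : ℤ) := by
      exact_mod_cast (Nat.div_add_mod t C.m).symm
    rw [show -((t : ℤ) + 1) + ((t % C.m : ℕ) : ℤ) + 1 = C.m * (-((t / C.m : ℕ) : ℤ)) by
      linear_combination -h]
    exact Int.mul_ediv_cancel_left _ hm
  have h3 := C.psiS_eq_psi0 (Nat.mod_lt t C.hm) c (-((t / C.m : ℕ) : ℤ) - 1)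
  rw [PhiW, h1, h2, hS, Int.toNat_natCast]
  rw [psiS] at h3
  rw [h3, creation]
  congr 1
  ext
  simp [flatIdx]

theorem Adet_eq_creationHom (hS : C.sig = 1) {l : ℕ} (hl : l ≤ C.n) :
    C.Adet l = C.creationHom (leadingMinor C.n l) := by
  rw [Adet, ncdet, leadingMinor, Matrix.det_apply, map_sum]
  refine Finset.sum_congr rfl fun σ _ => ?_
  rw [Units.smul_def, map_zsmul, Fin.prod_univ_def, map_list_prod, List.map_map]
  congr 2
  refine List.map_congr_left fun t _ => ?_
  have h : ((σ t : Fin l) : ℕ) < C.n := by omega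
  rw [Function.comp_apply, Matrix.of_apply, dif_pos h, creationHom_X,
    ← PhiW_eq_creation C hS]

theorem vSP_eq_fockVec (hS : C.sig = 1) (μ : ℕ → ℤ) :
    C.vSP μ = C.fockVec
      (minorProduct C.n fun l => (μ (l + 1) - μ (l + 2)).toNat) := by
  rw [vSP, fockVec_apply, minorProduct]
  congr 1
  have : (∏ l ∈ Finset.range C.n, leadingMinor C.n (l + 1) ^ (μ (l + 1) - μ (l + 2)).toNat)
      = ((List.range C.n).map fun l =>
          leadingMinor C.n (l + 1) ^ (μ (l + 1) - μ (l + 2)).toNat).prod := rfl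
  rw [this, map_list_prod, List.map_map]
  congr 1
  refine List.map_congr_left fun l hl => ?_
  rw [Function.comp_apply, map_pow, Adet_eq_creationHom C hS (by simpa using hl)]

/-- The eigenvalue of a diagonal column polarization on a product of leading minors. -/
def colWeight (e : ℕ → ℕ) (i : ℕ) (k : ℤ) : ℂ :=
  ∑ l ∈ Finset.range C.n, (e l : ℂ) * if 0 ≤ k ∧ i + C.m * k.toNat < l + 1 then 1 else 0

theorem colWeight_eq_zero (e : ℕ → ℕ) (i : ℕ) {k : ℤ} (hk : ¬ (0 ≤ k ∧ k ≤ C.n)) :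
    C.colWeight e i k = 0 := by
  refine Finset.sum_eq_zero fun l hl => ?_
  rw [Finset.mem_range] at hl
  rw [if_neg, mul_zero]
  rintro ⟨h0, h1⟩
  have := Nat.le_mul_of_pos_left k.toNat C.hm
  omega

theorem sum_nord_diagonal_smul_fockVec (hS : C.sig = 1) {i : ℕ} (hi : i < C.m) (k : ℤ)
    (e : ℕ → ℕ) :
    ∑ c : Fin C.n, C.nord (C.psiS (i + 1) ((c : ℕ) + 1) (-k - C.sig)) k
        (C.psibarS (i + 1) ((c : ℕ) + 1) k) • C.fockVec (minorProduct C.n e)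
      = C.colWeight e i k • C.fockVec (minorProduct C.n e) := by
  have h := C.sum_nord_psi_psibar_smul_fockVec hS hi hi (le_refl 0) k (minorProduct C.n e)
  simp only [zero_sub, sub_zero] at h
  rw [h, colWeight]
  split_ifs with hk
  · rw [colPolarization_minorProduct_self, map_smul]
    simp [hk]
  · simp [hk]

theorem finsum_mem_columnIndices {i l : ℕ} (hi : i < C.m) (hl : l ≤ C.n) (w : ℤ → ℂ) :
    (∑ᶠ k ∈ {k : ℤ | 1 ≤ k * (C.m : ℤ) + ((i + 1 : ℕ) : ℤ)
        ∧ k * (C.m : ℤ) + ((i + 1 : ℕ) : ℤ) ≤ (l : ℤ)}, w k)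
      = ∑ k ∈ Finset.Icc (-(C.n : ℤ) - 1) C.n,
          w k * if 0 ≤ k ∧ i + C.m * k.toNat < l then 1 else 0 := by
  have hmpos : (0 : ℤ) < C.m := by exact_mod_cast C.hm
  have hiff : ∀ k : ℤ, (1 ≤ k * (C.m : ℤ) + ((i + 1 : ℕ) : ℤ)
      ∧ k * (C.m : ℤ) + ((i + 1 : ℕ) : ℤ) ≤ (l : ℤ)) ↔ (0 ≤ k ∧ i + C.m * k.toNat < l) := by
    intro k
    rcases lt_or_ge k 0 with hk | hk
    · have : k * (C.m : ℤ) ≤ -1 * C.m := mul_le_mul_of_nonneg_right (by omega) hmpos.le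
      push_cast
      omega
    · obtain ⟨k, rfl⟩ := Int.eq_ofNat_of_zero_le hk
      have h1 : (k : ℤ) * C.m = ((C.m * k : ℕ) : ℤ) := by push_cast; ring
      rw [h1, Int.toNat_natCast]
      push_cast
      omega
  rw [finsum_mem_def, finsum_eq_sum_of_support_subset (s := Finset.Icc (-(C.n : ℤ) - 1) C.n)]
  · refine Finset.sum_congr rfl fun k _ => ?_
    rw [mul_ite, mul_one, mul_zero, Set.indicator_apply]
    exact if_congr (hiff k) rfl rfl
  · intro k hk
    have hk' := Set.mem_of_indicator_ne_zero (Function.mem_support.1 hk)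
    rw [Set.mem_ofPred_eq, hiff] at hk'
    have := Nat.le_mul_of_pos_left k.toNat C.hm
    simp only [Finset.coe_Icc, Set.mem_Icc]
    omega

theorem sum_mul_colWeight {i : ℕ} (hi : i < C.m) (e : ℕ → ℕ) (w : ℤ → ℂ) :
    ∑ k ∈ Finset.Icc (-(C.n : ℤ) - 1) C.n, w k * C.colWeight e i k
      = ∑ l ∈ Finset.range C.n, (e l : ℂ)
          * ∑ᶠ k ∈ {k : ℤ | 1 ≤ k * (C.m : ℤ) + ((i + 1 : ℕ) : ℤ)
              ∧ k * (C.m : ℤ) + ((i + 1 : ℕ) : ℤ) ≤ ((l + 1 : ℕ) : ℤ)}, w k := by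
  simp only [colWeight, Finset.mul_sum]
  rw [Finset.sum_comm]
  refine Finset.sum_congr rfl fun l hl => ?_
  rw [finsum_mem_columnIndices C hi (by simpa using hl), Finset.mul_sum]
  exact Finset.sum_congr rfl fun k _ => by ring

theorem qp_reflect (hS : C.sig = 1) (b k : ℤ) : C.qp b (-k - 1) = C.qpp b k := by
  rw [qp, qpp, hS]
  congr 1
  ring

theorem sum_Icc_one_eq_sum_range {M : Type*} [AddCommMonoid M] (n : ℕ) (g : ℕ → M) :
    ∑ k ∈ Finset.Icc 1 n, g k = ∑ l ∈ Finset.range n, g (l + 1) := by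
  rw [Finset.range_eq_Ico, Finset.sum_Ico_add' g 0 n 1]
  rfl

end WCtx

open WCtx in
/-- **Proposition 5.9.**  Assume `S = ℤ + 1/2` (i.e. `sig = 1`, `ε = 0`).  For a
partition `μ_1 ≥ ⋯ ≥ μ_n ≥ 0` (with `μ_{n+1} = 0`), the vector
`v_{μ,S} = A_1^{μ_1-μ_2} ⋯ A_n^{μ_n}|0⟩` is a nonzero joint highest weight vector
for the dual pair `(Sp_{2n}, ŝo_m(C_q))` acting on `F_N(ℤ+1/2)`. -/
theorem statement12 (C : WCtx) (hS : C.sig = 1) (μ : ℕ → ℤ)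
    (hdec : ∀ k : ℕ, 1 ≤ k → k < C.n → μ (k + 1) ≤ μ k)
    (hpos : 0 ≤ μ C.n) (htop : μ (C.n + 1) = 0) :
    C.vSP μ ≠ 0
    -- (a) the positive part of `ŝo_m(C_q)` kills `v_{μ,S}`
    ∧ (∀ i j : ℕ, 1 ≤ i → i ≤ C.m → 1 ≤ j → j ≤ C.m → ∀ a b : ℤ,
        (0 < a ∨ (a = 0 ∧ i < j)) →
        (∑ᶠ k : ℤ, (C.qp b k • ∑ c : Fin C.n,
            (C.nord (C.psiS i ((c : ℕ) + 1) (a - k - C.sig)) k (C.psibarS j ((c : ℕ) + 1) k)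
              - C.nord (C.psiS (C.m + 1 - j) ((c : ℕ) + 1) k) (a - k - C.sig)
                  (C.psibarS (C.m + 1 - i) ((c : ℕ) + 1) (a - k - C.sig)))) • C.vSP μ) = 0)
    -- (b) the Cartan part of `ŝo_m(C_q)` acts by the stated eigenvalue
    ∧ (∀ i : ℕ, 1 ≤ i → i ≤ C.m → ∀ b : ℤ,
        (∑ᶠ k : ℤ, (C.qp b k • ∑ c : Fin C.n,
            (C.nord (C.psiS i ((c : ℕ) + 1) (-k - C.sig)) k (C.psibarS i ((c : ℕ) + 1) k)
              - C.nord (C.psiS (C.m + 1 - i) ((c : ℕ) + 1) k) (-k - C.sig)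
                  (C.psibarS (C.m + 1 - i) ((c : ℕ) + 1) (-k - C.sig)))) • C.vSP μ)
          - (2 * (C.n : ℂ) * C.om b) • C.vSP μ
        = ((∑ k ∈ Finset.Icc 1 C.n, ((μ k - μ (k + 1) : ℤ) : ℂ) * C.Jsum i k b)
            - (∑ k ∈ Finset.Icc 1 C.n, ((μ k - μ (k + 1) : ℤ) : ℂ) * C.JsumP (C.m + 1 - i) k b)
            - 2 * (C.n : ℂ) * C.om b) • C.vSP μ)
    -- (c) the raising operators `f_{p,s}` of `sp_{2n}` kill `v_{μ,S}`
    ∧ (∀ p s : ℕ, 1 ≤ p → p < s → s ≤ C.n →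
        (∑ᶠ k : ℤ, (∑ c : Fin C.m,
            C.nord (C.psiS ((c : ℕ) + 1) p (-k - C.sig)) k
              (C.psibarS ((c : ℕ) + 1) s k)) • C.vSP μ) = 0)
    -- (d) the operators `g_{p,s}` of `sp_{2n}` kill `v_{μ,S}`
    ∧ (∀ p s : ℕ, 1 ≤ p → p ≤ s → s ≤ C.n →
        (∑ᶠ k : ℤ, (∑ c : Fin C.m,
            C.nord (C.psiS ((c : ℕ) + 1) p (-k - C.sig)) k
              (C.psiS (C.m - (c : ℕ)) s k)) • C.vSP μ) = 0)
    -- (e) the Cartan of `sp_{2n}` acts by `μ_p`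
    ∧ (∀ p : ℕ, 1 ≤ p → p ≤ C.n →
        (∑ᶠ k : ℤ, (∑ c : Fin C.m,
            C.nord (C.psiS ((c : ℕ) + 1) p (-k - C.sig)) k
              (C.psibarS ((c : ℕ) + 1) p k)) • C.vSP μ)
          = ((μ p : ℤ) : ℂ) • C.vSP μ) := by
  have hm := C.hm
  set e : ℕ → ℕ := fun l => (μ (l + 1) - μ (l + 2)).toNat with he
  have hv : C.vSP μ = C.fockVec (minorProduct C.n e) := C.vSP_eq_fockVec hS μ
  have hcast : ∀ l ∈ Finset.range C.n,
      (e l : ℂ) = ((μ (l + 1) - μ (l + 2) : ℤ) : ℂ) := by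
    intro l hl
    rw [Finset.mem_range] at hl
    have hnonneg : 0 ≤ μ (l + 1) - μ (l + 2) := by
      rcases Nat.lt_or_ge (l + 1) C.n with h | h
      · linarith [hdec (l + 1) (by omega) h]
      · have h1 : l + 1 = C.n := by omega
        rw [show l + 2 = C.n + 1 by omega, h1, htop]
        linarith
    rw [← Int.cast_natCast, he, Int.toNat_of_nonneg hnonneg]
  refine ⟨?_, ?_, ?_, ?_, ?_, ?_⟩
  · rw [hv]
    refine C.fockVec_ne_zero hS ?_
    rw [eval_minorProduct]
    exact one_ne_zero
  · intro i j hi1 hi2 hj1 hj2 a b hab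
    obtain ⟨i, rfl⟩ : ∃ i', i = i' + 1 := ⟨i - 1, by omega⟩
    obtain ⟨j, rfl⟩ : ∃ j', j = j' + 1 := ⟨j - 1, by omega⟩
    have ha : 0 ≤ a := by omega
    have hzero : ∀ (i j : ℕ), i < C.m → j < C.m → (0 < a ∨ (a = 0 ∧ i < j)) → ∀ k : ℤ,
        ∑ c : Fin C.n, C.nord (C.psiS (i + 1) ((c : ℕ) + 1) (a - k - C.sig)) k
          (C.psibarS (j + 1) ((c : ℕ) + 1) k) • C.fockVec (minorProduct C.n e) = 0 := by
      intro i j hi hj hij k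
      rw [C.sum_nord_psi_psibar_smul_fockVec hS hi hj ha]
      split_ifs with hak
      · rw [colPolarization_minorProduct_of_lt, map_zero]
        rcases hij with h | ⟨rfl, h⟩
        · have h1 : C.m * ((k - a).toNat + 1) ≤ C.m * k.toNat :=
            Nat.mul_le_mul_left _ (by omega)
          rw [Nat.mul_add] at h1
          omega
        · rw [sub_zero]
          omega
      · rfl
    rw [← finsum_zero (α := ℤ)]
    refine finsum_congr fun k => ?_
    rw [hv, smul_assoc, Finset.sum_smul]
    simp only [sub_smul]
    rw [Finset.sum_sub_distrib, hzero i j (by omega) (by omega) (by omega) k]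
    have h2 := hzero (C.m - (j + 1)) (C.m - (i + 1)) (by omega) (by omega) (by omega)
      (a - k - C.sig)
    rw [show a - (a - k - C.sig) - C.sig = k by ring,
      show C.m - (j + 1) + 1 = C.m + 1 - (j + 1) by omega,
      show C.m - (i + 1) + 1 = C.m + 1 - (i + 1) by omega] at h2
    rw [h2, sub_zero, smul_zero]
  · intro i hi1 hi2 b
    obtain ⟨i, rfl⟩ : ∃ i', i = i' + 1 := ⟨i - 1, by omega⟩
    have hi : i < C.m := by omega
    have hi' : C.m - (i + 1) < C.m := by omega
    rw [hv, sub_smul _ (2 * (C.n : ℂ) * C.om b)]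
    congr 1
    have hterm : ∀ k : ℤ, (C.qp b k • ∑ c : Fin C.n,
            (C.nord (C.psiS (i + 1) ((c : ℕ) + 1) (-k - C.sig)) k
                (C.psibarS (i + 1) ((c : ℕ) + 1) k)
              - C.nord (C.psiS (C.m + 1 - (i + 1)) ((c : ℕ) + 1) k) (-k - C.sig)
                  (C.psibarS (C.m + 1 - (i + 1)) ((c : ℕ) + 1) (-k - C.sig))))
            • C.fockVec (minorProduct C.n e)
          = (C.qp b k * C.colWeight e i k
              - C.qp b k * C.colWeight e (C.m - (i + 1)) (-k - 1))
            • C.fockVec (minorProduct C.n e) := by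
      intro k
      rw [smul_assoc, Finset.sum_smul]
      simp only [sub_smul]
      have h2 := C.sum_nord_diagonal_smul_fockVec hS hi' (-k - C.sig) e
      rw [show -(-k - C.sig) - C.sig = k by ring,
        show C.m - (i + 1) + 1 = C.m + 1 - (i + 1) by omega] at h2
      rw [Finset.sum_sub_distrib, C.sum_nord_diagonal_smul_fockVec hS hi, h2, smul_sub, smul_smul,
        smul_smul, hS]
    simp only [hterm]
    rw [finsum_eq_sum_of_support_subset (s := Finset.Icc (-(C.n : ℤ) - 1) C.n), ← Finset.sum_smul,
      Finset.sum_sub_distrib]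
    · have hreflect : ∑ k ∈ Finset.Icc (-(C.n : ℤ) - 1) C.n,
          C.qp b k * C.colWeight e (C.m - (i + 1)) (-k - 1)
          = ∑ k ∈ Finset.Icc (-(C.n : ℤ) - 1) C.n,
            C.qpp b k * C.colWeight e (C.m - (i + 1)) k := by
        refine Finset.sum_nbij' (fun k => -k - 1) (fun k => -k - 1) ?_ ?_ ?_ ?_ ?_
        · intro k hk
          rw [Finset.mem_Icc] at hk ⊢
          omega
        · intro k hk
          rw [Finset.mem_Icc] at hk ⊢
          omega
        · intro k _
          ring
        · intro k _
          ring
        · intro k _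
          rw [← C.qp_reflect hS, show -(-k - 1) - 1 = k by ring]
      rw [hreflect, C.sum_mul_colWeight hi, C.sum_mul_colWeight hi', sum_Icc_one_eq_sum_range,
        sum_Icc_one_eq_sum_range]
      congr 2
      · exact Finset.sum_congr rfl fun l hl => by rw [hcast l hl, Jsum]
      · refine Finset.sum_congr rfl fun l hl => ?_
        rw [hcast l hl, JsumP, show C.m + 1 - (i + 1) = C.m - (i + 1) + 1 by omega]
    · intro k hk
      simp only [Finset.coe_Icc, Set.mem_Icc]
      by_contra hcon
      refine (Function.mem_support.1 hk) ?_
      rw [C.colWeight_eq_zero e i (by omega), C.colWeight_eq_zero e _ (by omega), mul_zero,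
        sub_zero, zero_smul]
  · intro p s hp hps hs
    obtain ⟨p, rfl⟩ : ∃ p', p = p' + 1 := ⟨p - 1, by omega⟩
    obtain ⟨s, rfl⟩ : ∃ s', s = s' + 1 := ⟨s - 1, by omega⟩
    rw [hv]
    refine (C.finsum_rowOperator_smul_fockVec hS ⟨p, by omega⟩ ⟨s, by omega⟩ e).trans ?_
    rw [rowPolarization_minorProduct_of_lt (Nat.le_mul_of_pos_right _ hm)
      (Fin.mk_lt_mk.2 (by omega)), map_zero]
  · intro p s hp hps hs
    obtain ⟨p, rfl⟩ : ∃ p', p = p' + 1 := ⟨p - 1, by omega⟩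
    obtain ⟨s, rfl⟩ : ∃ s', s = s' + 1 := ⟨s - 1, by omega⟩
    rw [← finsum_zero (α := ℤ)]
    refine finsum_congr fun k => ?_
    rw [hv, Finset.sum_smul]
    refine Finset.sum_eq_zero fun c _ => ?_
    rw [show C.m - (c : ℕ) = C.m - (c + 1) + 1 by omega]
    exact C.nord_psi_psi_smul_fockVec hS c.2 (by omega) ⟨p, by omega⟩ ⟨s, by omega⟩ k _
  · intro p hp hpn
    obtain ⟨p, rfl⟩ : ∃ p', p = p' + 1 := ⟨p - 1, by omega⟩
    rw [hv]
    refine (C.finsum_rowOperator_smul_fockVec hS ⟨p, by omega⟩ ⟨p, by omega⟩ e).trans ?_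
    rw [rowPolarization_minorProduct_self (Nat.le_mul_of_pos_right _ hm), map_smul]
    congr 1
    have htel : ∀ d, p + d ≤ C.n → ∑ l ∈ Finset.range (p + d),
        (((μ (l + 1) - μ (l + 2) : ℤ) : ℂ) * if p < l + 1 then 1 else 0)
        = ((μ (p + 1) - μ (p + d + 1) : ℤ) : ℂ) := by
      intro d
      induction d with
      | zero =>
        intro _
        rw [add_zero, sub_self, Int.cast_zero]
        refine Finset.sum_eq_zero fun l hl => ?_
        rw [Finset.mem_range] at hl
        rw [if_neg (by omega), mul_zero]
      | succ d ih =>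
        intro hd
        rw [← add_assoc, Finset.sum_range_succ, ih (by omega), if_pos (by omega)]
        push_cast
        ring
    rw [Finset.sum_congr rfl fun l hl => by rw [hcast l hl]]
    have h := htel (C.n - p) (by omega)
    rw [show p + (C.n - p) = C.n by omega, htop, sub_zero] at h
    exact h
end
end

section
/- Let 1 ≤ i, j ≤ m, a ∈ ℤ, r ∈ S, 1 ≤ l ≤ ⌊n/2⌋, and assume either a > 0, or a = 0 and S = ℤ + 1/2. When α(−r,0,j) ∈ I_{lbar2}, let C_l^{r,i,j} be the determinant obtained from B_l by replacing its (lbar1 + α(−r,0,j))-th column by the column (−phi^1_{α(r,a,i)−1/2−ε}, …, −phi^l_{α(r,a,i)−1/2−ε})^t; when α(r,a,i) ∈ I_{lbar2}, let Cbar_l^{r,i,j} be the determinant obtained from B_l by replacing its (lbar1 + α(r,a,i))-th column by the column (−phi^1_{α(−r,0,j)−1/2−ε}, …, −phi^l_{α(−r,0,j)−1/2−ε})^t. Then [Σ_{k=1}^{n} psi_i^k(a−r) psi_j^{n+1−k}(r), B_l] equals C_l^{r,i,j} + Cbar_l^{r,i,j} if both α(−r,0,j) ∈ I_{lbar2} and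 α(r,a,i) ∈ I_{lbar2}; equals C_l^{r,i,j} if α(−r,0,j) ∈ I_{lbar2} and α(r,a,i) ∉ I_{lbar2}; equals Cbar_l^{r,i,j} if α(r,a,i) ∈ I_{lbar2} and α(−r,0,j) ∉ I_{lbar2}; and equals 0 otherwise. Furthermore: if α(−r,0,j) ∈ I_{lbar2} then C_l^{r,i,j}|0⟩ = 0 in F_N(S), [B_{l'}, C_l^{r,i,j}] = 0 for every 1 ≤ l' ≤ n with l' + l ≤ n, and, when n is even, [Bbar_{n/2}, C_{l''}^{r,i,j}] = 0 for every 1 ≤ l'' < n/2 for which C_{l''}^{r,i,j} is defined; if α(r,a,i) ∈ I_{lbar2} then Cbar_l^{r,i,j}|0⟩ = 0, [B_{l'}, Cbar_l^{r,i,j}] = 0 for l' + l ≤ n, and, when n is even, [Bbar_{n/2}, Cbar_{l''}^{r,i,j}] = 0 for every 1 ≤ l'' < n/2 for which Cbar_{l''}^{r,i,j} is defined. -/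
noncomputable section

namespace WCtx

variable (C : WCtx)

theorem commute_psiF (i j : ℕ) (k l : ℤ) : Commute (C.psiF i k) (C.psiF j l) := by
  unfold psiF
  split_ifs
  · have h := RingQuot.mkAlgHom_rel ℂ (rel.comm_psi (C := C) ⟨i - 1, by omega⟩ ⟨j - 1, by omega⟩ k l)
    rw [map_mul, map_mul] at h
    exact h
  all_goals simp

theorem commute_psibarF (i j : ℕ) (k l : ℤ) : Commute (C.psibarF i k) (C.psibarF j l) := by
  unfold psibarF
  split_ifs
  · have h := RingQuot.mkAlgHom_rel ℂ
      (rel.comm_psibar (C := C) ⟨i - 1, by omega⟩ ⟨j - 1, by omega⟩ k l)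
    rw [map_mul, map_mul] at h
    exact h
  all_goals simp

theorem psibarF_mul_psiF {i j : ℕ} (hi : 1 ≤ i ∧ i ≤ C.NN) (hj : 1 ≤ j ∧ j ≤ C.NN) (k l : ℤ) :
    C.psibarF i k * C.psiF j l
      = C.psiF j l * C.psibarF i k + if i = j ∧ k + l + C.sig = 0 then 1 else 0 := by
  rw [psibarF, psiF, dif_pos hi, dif_pos hj]
  have h := RingQuot.mkAlgHom_rel ℂ
    (rel.mixed (C := C) ⟨i - 1, by omega⟩ ⟨j - 1, by omega⟩ k l)
  have e : (⟨i - 1, by omega⟩ : Fin C.NN) = ⟨j - 1, by omega⟩ ↔ i = j := by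
    rw [Fin.mk.injEq]; omega
  rw [map_add, map_mul, map_mul, apply_ite (RingQuot.mkAlgHom ℂ C.rel), map_one, map_zero] at h
  simp only [e] at h
  exact h

theorem commute_psibarF_psiF {i j : ℕ} {k l : ℤ} (h : ¬(i = j ∧ k + l + C.sig = 0)) :
    Commute (C.psibarF i k) (C.psiF j l) := by
  by_cases hi : 1 ≤ i ∧ i ≤ C.NN
  · by_cases hj : 1 ≤ j ∧ j ≤ C.NN
    · have := C.psibarF_mul_psiF hi hj k l
      rwa [if_neg h, add_zero] at this
    · simp [psiF, hj]
  · simp [psibarF, hi]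

theorem commute_PhiW (c d : ℕ) (s t : ℤ) : Commute (C.PhiW c s) (C.PhiW d t) :=
  C.commute_psiF _ _ _ _

theorem commute_PhibarW (c d : ℕ) (s t : ℤ) : Commute (C.PhibarW c s) (C.PhibarW d t) :=
  C.commute_psibarF _ _ _ _

theorem m_pos : (0 : ℤ) < C.m := by exact_mod_cast C.hm

theorem PhiW_eq_psiS {i : ℕ} (hi : 1 ≤ i) (hi' : i ≤ C.m) (c : ℕ) (k : ℤ) :
    C.PhiW c ((k + C.sig) * C.m - i) = C.psiS i c k := by
  have hm := C.m_pos
  have h : (-((k + C.sig) * C.m - i : ℤ) - 1).emod C.m = (i : ℤ) - 1 := by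
    change (-((k + C.sig) * C.m - i : ℤ) - 1) % C.m = (i : ℤ) - 1
    rw [show (-((k + C.sig) * C.m - i : ℤ) - 1) = ((i : ℤ) - 1) + (-(k + C.sig)) * C.m by ring,
      Int.add_mul_emod_self_right]
    exact Int.emod_eq_of_lt (by omega) (by omega)
  rw [PhiW, psiS, h]
  congr 1
  · omega
  · rw [show ((k + C.sig) * C.m - i + ((i : ℤ) - 1) + 1 : ℤ) = (k + C.sig) * C.m by ring,
      Int.mul_ediv_cancel _ hm.ne']
    ring

theorem PhibarW_eq_psibarS {i : ℕ} (hi : 1 ≤ i) (hi' : i ≤ C.m) (c : ℕ) (k : ℤ) :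
    C.PhibarW c (k * C.m + i - 1) = C.psibarS i c k := by
  have hm := C.m_pos
  have h : (k * C.m + i - 1 : ℤ).emod C.m = (i : ℤ) - 1 := by
    change (k * C.m + i - 1 : ℤ) % C.m = (i : ℤ) - 1
    rw [show (k * C.m + i - 1 : ℤ) = ((i : ℤ) - 1) + k * C.m by ring,
      Int.add_mul_emod_self_right]
    exact Int.emod_eq_of_lt (by omega) (by omega)
  rw [PhibarW, psibarS, h]
  congr 1
  · omega
  · rw [show (k * C.m + i - 1 - ((i : ℤ) - 1) : ℤ) = k * C.m by ring,
      Int.mul_ediv_cancel _ hm.ne']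

theorem exists_PhiW_index (t : ℤ) :
    ∃ (i : ℕ) (k : ℤ), 1 ≤ i ∧ i ≤ C.m ∧ t = (k + C.sig) * C.m - i := by
  have hm := C.m_pos
  have h0 := Int.emod_nonneg (-t - 1) hm.ne'
  have h1 := Int.emod_lt_of_pos (-t - 1) hm
  have h2 := Int.emod_add_mul_ediv (-t - 1) C.m
  refine ⟨((-t - 1) % C.m).toNat + 1, -((-t - 1) / C.m) - C.sig, by omega, by omega, ?_⟩
  push_cast
  rw [Int.toNat_of_nonneg h0]
  linear_combination h2

theorem exists_PhibarW_index (t : ℤ) :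
    ∃ (i : ℕ) (k : ℤ), 1 ≤ i ∧ i ≤ C.m ∧ t = k * C.m + i - 1 := by
  have hm := C.m_pos
  have h0 := Int.emod_nonneg t hm.ne'
  have h1 := Int.emod_lt_of_pos t hm
  have h2 := Int.emod_add_mul_ediv t C.m
  refine ⟨(t % C.m).toNat + 1, t / C.m, by omega, by omega, ?_⟩
  push_cast
  rw [Int.toNat_of_nonneg h0]
  linear_combination -h2

/-- A residue in `{1,…,m}` and the block number are determined by `i + q·m`. -/
theorem eq_of_add_mul_eq {i j : ℕ} (hi : 1 ≤ i) (hi' : i ≤ C.m) (hj : 1 ≤ j) (hj' : j ≤ C.m)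
    {p q : ℤ} (h : (i : ℤ) + p * C.m = j + q * C.m) : i = j ∧ p = q := by
  have hm := C.m_pos
  have hpq : p = q := by
    rcases lt_trichotomy p q with hlt | heq | hlt
    · nlinarith
    · exact heq
    · nlinarith
  subst hpq
  exact ⟨by omega, rfl⟩

theorem flat_index_eq_iff {i j c d : ℕ} (hi : 1 ≤ i) (hi' : i ≤ C.m) (hj : 1 ≤ j) (hj' : j ≤ C.m)
    (hc : 1 ≤ c) (hd : 1 ≤ d) : i + (c - 1) * C.m = j + (d - 1) * C.m ↔ i = j ∧ c = d := by
  constructor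
  · intro h
    have h' : (i : ℤ) + ((c - 1 : ℕ) : ℤ) * C.m = j + ((d - 1 : ℕ) : ℤ) * C.m := by exact_mod_cast h
    have := C.eq_of_add_mul_eq hi hi' hj hj' h'
    omega
  · rintro ⟨rfl, rfl⟩
    rfl

theorem flat_index_le {i c : ℕ} (hi' : i ≤ C.m) (hc : 1 ≤ c) (hc' : c ≤ C.n) :
    i + (c - 1) * C.m ≤ C.NN := by
  obtain ⟨c, rfl⟩ := Nat.exists_eq_add_of_le' hc
  rw [NN]
  simp only [Nat.add_sub_cancel]
  nlinarith

theorem pairing_index_iff {i j c d : ℕ} {s t k l : ℤ}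
    (hi : 1 ≤ i) (hi' : i ≤ C.m) (hj : 1 ≤ j) (hj' : j ≤ C.m)
    (hc : 1 ≤ c) (hd : 1 ≤ d) (hs : s = k * C.m + i - 1) (ht : t = (l + C.sig) * C.m - j) :
    (i + (c - 1) * C.m = j + (d - 1) * C.m ∧ k + l + C.sig = 0) ↔ c = d ∧ s + t + 1 = 0 := by
  rw [C.flat_index_eq_iff hi hi' hj hj' hc hd]
  constructor
  · rintro ⟨⟨rfl, rfl⟩, h⟩
    refine ⟨rfl, ?_⟩
    rw [hs, ht]
    linear_combination (C.m : ℤ) * h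
  · rintro ⟨rfl, h⟩
    have := C.eq_of_add_mul_eq hi hi' hj hj' (p := k) (q := -(l + C.sig))
      (by rw [hs, ht] at h; linear_combination h)
    exact ⟨⟨this.1, rfl⟩, by omega⟩

theorem PhibarW_mul_PhiW {c d : ℕ} (hc : 1 ≤ c) (hc' : c ≤ C.n) (hd : 1 ≤ d) (hd' : d ≤ C.n)
    (s t : ℤ) :
    C.PhibarW c s * C.PhiW d t
      = C.PhiW d t * C.PhibarW c s + if c = d ∧ s + t + 1 = 0 then 1 else 0 := by
  obtain ⟨i, k, hi, hi', hs⟩ := C.exists_PhibarW_index s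
  obtain ⟨j, l, hj, hj', ht⟩ := C.exists_PhiW_index t
  simp only [← C.pairing_index_iff hi hi' hj hj' hc hd hs ht]
  rw [hs, ht, C.PhibarW_eq_psibarS hi hi', C.PhiW_eq_psiS hj hj']
  exact C.psibarF_mul_psiF ⟨by omega, C.flat_index_le hi' hc hc'⟩
    ⟨by omega, C.flat_index_le hj' hd hd'⟩ k l

theorem commute_PhibarW_PhiW {c d : ℕ} (hc : 1 ≤ c) (hd : 1 ≤ d) {s t : ℤ}
    (h : ¬(c = d ∧ s + t + 1 = 0)) : Commute (C.PhibarW c s) (C.PhiW d t) := by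
  obtain ⟨i, k, hi, hi', hs⟩ := C.exists_PhibarW_index s
  obtain ⟨j, l, hj, hj', ht⟩ := C.exists_PhiW_index t
  rw [← C.pairing_index_iff hi hi' hj hj' hc hd hs ht] at h
  rw [hs, ht, C.PhibarW_eq_psibarS hi hi', C.PhiW_eq_psiS hj hj']
  exact C.commute_psibarF_psiF h

theorem PhiW_smul_vac (c : ℕ) {t : ℤ} (ht : 0 ≤ t) : C.PhiW c t • C.vac = 0 := by
  obtain ⟨i, k, hi, hi', rfl⟩ := C.exists_PhiW_index t
  rw [C.PhiW_eq_psiS hi hi', psiS, psiF]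
  split_ifs with h
  · have hk : 0 < 2 * k + C.sig := by
      have hm := C.m_pos
      have : 0 < k + C.sig := by
        by_contra hcon
        nlinarith
      rcases C.hsig with h | h <;> omega
    have hmem : C.psi0 ⟨i + (c - 1) * C.m - 1, by omega⟩ k ∈ C.vacIdeal :=
      Submodule.subset_span (Or.inl ⟨_, k, hk, Or.inl rfl⟩)
    have h0 : (Submodule.Quotient.mk (C.psi0 ⟨i + (c - 1) * C.m - 1, by omega⟩ k • (1 : C.W)) :
        C.W ⧸ C.vacIdeal) = 0 := by
      rw [Submodule.Quotient.mk_eq_zero, smul_eq_mul, mul_one]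
      exact hmem
    exact h0
  · exact zero_smul _ _

section ncdet

variable {C}

theorem commute_ncdet {l : ℕ} {x : C.W} {M : Fin l → Fin l → C.W}
    (h : ∀ a b, Commute x (M a b)) : Commute x (C.ncdet M) := by
  refine Commute.sum_right _ _ _ fun p _ => Commute.smul_right ?_ _
  refine Commute.list_prod_right _ _ fun y hy => ?_
  obtain ⟨t, -, rfl⟩ := List.mem_map.1 hy
  exact h _ _

theorem ncdet_commute_ncdet {l l' : ℕ} {M : Fin l → Fin l → C.W} {M' : Fin l' → Fin l' → C.W}
    (h : ∀ a b a' b', Commute (M a b) (M' a' b')) : Commute (C.ncdet M) (C.ncdet M') :=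
  commute_ncdet fun a' b' => (commute_ncdet fun a b => (h a b a' b').symm).symm

open scoped IsMulCommutative in
/-- A determinant with pairwise commuting entries is the image of a determinant over a
commutative ring. -/
theorem exists_det_eq_ncdet {l : ℕ} {M : Fin l → Fin l → C.W}
    (h : ∀ a b a' b', Commute (M a b) (M a' b')) :
    ∃ (R : Type) (_ : CommRing R) (f : R →+* C.W) (A : Matrix (Fin l) (Fin l) R),
      Function.Injective f ∧ (∀ a b, f (A a b) = M a b) ∧ C.ncdet M = f A.det := by
  let s : Set C.W := Set.range fun q : Fin l × Fin l => M q.1 q.2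
  have hs : ∀ x ∈ s, ∀ y ∈ s, x * y = y * x := by
    rintro _ ⟨q, rfl⟩ _ ⟨q', rfl⟩
    exact h _ _ _ _
  have := Subring.isMulCommutative_closure hs
  refine ⟨Subring.closure s, inferInstance, (Subring.closure s).subtype,
    Matrix.of fun a b => ⟨M a b, Subring.subset_closure (Set.mem_range_self (a, b))⟩,
    Subtype.val_injective, fun _ _ => rfl, ?_⟩
  rw [Matrix.det_apply, map_sum, ncdet]
  refine Finset.sum_congr rfl fun p _ => ?_
  rw [Units.smul_def, map_zsmul, Fin.prod_univ_def, map_list_prod, List.map_map]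
  rfl

theorem ncdet_eq_zero_of_column_eq_neg {l : ℕ} {M : Fin l → Fin l → C.W}
    (h : ∀ a b a' b', Commute (M a b) (M a' b')) {s t : Fin l} (hst : s ≠ t)
    (hcol : ∀ a, M a s = -M a t) : C.ncdet M = 0 := by
  obtain ⟨R, _, f, A, hf, hA, hdet⟩ := exists_det_eq_ncdet h
  have hneg : ∀ a, A a s = -A a t := fun a => hf (by rw [map_neg, hA, hA, hcol])
  have hA0 : (A.updateCol s fun a => -A a t) = A := by
    ext a b
    by_cases hb : b = s
    · subst hb; simp [hneg]
    · simp [hb]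
  have : A.det = 0 := by
    rw [← hA0, show (fun a => -A a t) = (-1 : R) • fun a => A a t by ext; simp,
      Matrix.det_updateCol_smul, Matrix.det_zero_of_column_eq hst, mul_zero]
    intro a
    simp [hst.symm]
  rw [hdet, this, map_zero]

theorem ncdet_smul_eq_zero {l : ℕ} {M : Fin l → Fin l → C.W}
    (h : ∀ a b a' b', Commute (M a b) (M a' b')) (s : Fin l) {v : C.F}
    (hv : ∀ a, M a s • v = 0) : C.ncdet M • v = 0 := by
  obtain ⟨R, _, f, A, -, hA, hdet⟩ := exists_det_eq_ncdet h
  rw [hdet, Matrix.det_apply, map_sum, Finset.sum_smul]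
  refine Finset.sum_eq_zero fun p _ => ?_
  rw [Units.smul_def, map_zsmul, ← Finset.prod_erase_mul _ _ (Finset.mem_univ s), map_mul, hA,
    ← smul_mul_assoc, mul_smul, hv, smul_zero]

/-- The commutator with `x` is a derivation along an ordered product. -/
theorem commutator_list_prod {ι : Type*} [DecidableEq ι] {A : Type*} [Ring A] (x : A)
    (f D : ι → A) (hD : ∀ t, x * f t - f t * x = D t) {L : List ι} (hL : L.Nodup) :
    x * (L.map f).prod - (L.map f).prod * x
      = (L.map fun s => (L.map fun t => if t = s then D t else f t).prod).sum := by
  induction L with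
  | nil => simp
  | cons b L ih =>
    obtain ⟨hb, hL⟩ := List.nodup_cons.1 hL
    have h1 : (L.map fun t => if t = b then D t else f t) = L.map f :=
      List.map_congr_left fun t ht => if_neg (by rintro rfl; exact hb ht)
    have h2 : (L.map fun s => ((b :: L).map fun t => if t = s then D t else f t).prod)
        = L.map fun s => f b * (L.map fun t => if t = s then D t else f t).prod :=
      List.map_congr_left fun s hs => by
        rw [List.map_cons, List.prod_cons, if_neg (by rintro rfl; exact hb hs)]
    rw [List.map_cons (f := fun s => (List.map _ (b :: L)).prod), List.sum_cons, h2,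
      List.sum_map_mul_left, ← ih hL, List.map_cons, List.prod_cons, List.map_cons,
      List.prod_cons, h1, if_pos rfl, ← hD b]
    noncomm_ring

theorem commutator_ncdet {l : ℕ} (x : C.W) (M D : Fin l → Fin l → C.W)
    (hD : ∀ a t, x * M a t - M a t * x = D a t) :
    x * C.ncdet M - C.ncdet M * x
      = ∑ s, C.ncdet fun a t => if t = s then D a t else M a t := by
  simp only [ncdet]
  rw [Finset.sum_comm, Finset.mul_sum, Finset.sum_mul, ← Finset.sum_sub_distrib]
  refine Finset.sum_congr rfl fun p _ => ?_
  rw [mul_smul_comm, smul_mul_assoc, ← smul_sub, ← Finset.smul_sum,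
    commutator_list_prod x (fun t => M (p t) t) (fun t => D (p t) t) (fun t => hD _ _)
      (List.nodup_finRange l), Fin.sum_univ_def]

theorem list_prod_replace_add {ι : Type*} [DecidableEq ι] {A : Type*} [Ring A]
    (f D E : ι → A) (s : ι) {L : List ι} (hL : L.Nodup) (hs : s ∈ L) :
    (L.map fun t => if t = s then D t + E t else f t).prod
      = (L.map fun t => if t = s then D t else f t).prod
        + (L.map fun t => if t = s then E t else f t).prod := by
  induction L with
  | nil => simp at hs
  | cons b L ih =>
    obtain ⟨hb, hL⟩ := List.nodup_cons.1 hL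
    simp only [List.map_cons, List.prod_cons]
    by_cases hbs : b = s
    · subst hbs
      have h1 (G : ι → A) : (L.map fun t => if t = b then G t else f t) = L.map f :=
        List.map_congr_left fun t ht => if_neg (by rintro rfl; exact hb ht)
      rw [h1 D, h1 E, h1 fun t => D t + E t]
      simp [add_mul]
    · simp only [if_neg hbs]
      rw [ih hL ((List.mem_cons.1 hs).resolve_left (Ne.symm hbs)), mul_add]

theorem ncdet_replace_add {l : ℕ} (M D E : Fin l → Fin l → C.W) (s : Fin l) :
    C.ncdet (fun a t => if t = s then D a t + E a t else M a t)
      = C.ncdet (fun a t => if t = s then D a t else M a t)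
        + C.ncdet (fun a t => if t = s then E a t else M a t) := by
  simp only [ncdet]
  rw [← Finset.sum_add_distrib]
  refine Finset.sum_congr rfl fun p _ => ?_
  rw [← smul_add, ← list_prod_replace_add (fun t => M (p t) t) (fun t => D (p t) t)
    (fun t => E (p t) t) s (List.nodup_finRange l) (List.mem_finRange s)]

theorem ncdet_eq_zero_of_column_zero {l : ℕ} {M : Fin l → Fin l → C.W} (s : Fin l)
    (h : ∀ a, M a s = 0) : C.ncdet M = 0 := by
  refine Finset.sum_eq_zero fun p _ => ?_
  rw [List.prod_eq_zero, smul_zero]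
  exact List.mem_map.2 ⟨s, List.mem_finRange s, h _⟩

end ncdet

theorem lb_cases {l : ℕ} (hl : 1 ≤ l) :
    ∃ h r : ℕ, r < C.m ∧
      ((C.lb1 l = h * C.m + (r + 1) ∧ C.lb2 l = h * C.m) ∨
        (C.lb1 l = (h + 1) * C.m ∧ C.lb2 l = h * C.m + (r + 1))) ∧ l = C.lb1 l + C.lb2 l := by
  have hr := Nat.mod_lt (l - 1) C.hm
  have hdm := Nat.div_add_mod (l - 1) C.m
  rw [lb2, lb1]
  generalize (l - 1) / C.m = q at *
  generalize (l - 1) % C.m = r at *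
  refine ⟨q / 2, r, hr, ?_⟩
  have hl2 : l = C.m * q + r + 1 := by omega
  subst hl2
  rcases Nat.mod_two_eq_zero_or_one q with h | h
  · obtain ⟨p, rfl⟩ : ∃ p, q = 2 * p := ⟨q / 2, by omega⟩
    have e : C.m * (2 * p) = p * C.m + p * C.m := by ring
    rw [if_pos h, Nat.mul_div_cancel_left _ two_pos, e]
    omega
  · obtain ⟨p, rfl⟩ : ∃ p, q = 2 * p + 1 := ⟨q / 2, by omega⟩
    have e : C.m * (2 * p + 1) = p * C.m + p * C.m + C.m := by ring
    have e1 : (2 * p + 1 + 1) / 2 = p + 1 := by omega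
    have e2 : (2 * p + 1) / 2 = p := by omega
    rw [if_neg (by omega), e1, e2, e, add_mul, one_mul]
    omega

theorem lb1_add_lb2 {l : ℕ} (hl : 1 ≤ l) : C.lb1 l + C.lb2 l = l := by
  obtain ⟨-, -, -, -, h⟩ := C.lb_cases hl
  exact h.symm

theorem mul_le_lb1 {l j : ℕ} (hl : 1 ≤ l) (hj' : j ≤ C.m) {K : ℤ}
    (h : K * C.m - j + 1 ≤ C.lb2 l) : K * C.m ≤ C.lb1 l := by
  have hm := C.m_pos
  obtain ⟨b, r, hr, ⟨h1, h2⟩ | ⟨h1, h2⟩, -⟩ := C.lb_cases hl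
  · rw [h2] at h
    rw [h1]
    push_cast at h ⊢
    have : K ≤ b := by
      by_contra hcon
      have : (b : ℤ) + 1 ≤ K := by omega
      nlinarith
    nlinarith
  · rw [h2] at h
    rw [h1]
    push_cast at h ⊢
    have : K ≤ b + 1 := by
      by_contra hcon
      have : (b : ℤ) + 2 ≤ K := by omega
      nlinarith
    nlinarith

/-- If the column index `x` of a `φ` is negative and paired with a column of `B_l` as in `C_l`,
then `φ_x` is already a column of `B_l`. -/
theorem neg_le_lb1 {l i j : ℕ} (hl : 1 ≤ l) (hj' : j ≤ C.m) {K b : ℤ} (hi' : i ≤ C.m)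
    (hb : 1 ≤ b) (h : K * C.m - j + 1 ≤ C.lb2 l) :
    -((b - K) * C.m - i) ≤ C.lb1 l := by
  have := C.mul_le_lb1 hl hj' h
  have hm := C.m_pos
  nlinarith

theorem alphaV_sub_one (k a : ℤ) (i : ℕ) : C.alphaV k a i - 1 = (a - k) * C.m - i := by
  rw [alphaV]; ring

theorem psiS_eq_PhiW {i : ℕ} (hi : 1 ≤ i) (hi' : i ≤ C.m) (c : ℕ) (a k : ℤ) :
    C.psiS i c (a - k - C.sig) = C.PhiW c (C.alphaV k a i - 1) := by
  rw [alphaV_sub_one, ← C.PhiW_eq_psiS hi hi', sub_add_cancel]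

theorem commute_PhiW_Bentry {l d : ℕ} (hd : 1 ≤ d) (hdl : d + l ≤ C.n) (x : ℤ)
    (k t : Fin l) : Commute (C.PhiW d x) (C.Bentry l k t) := by
  unfold Bentry
  have := k.2
  split_ifs
  · exact C.commute_PhiW _ _ _ _
  · exact (C.commute_PhibarW_PhiW (by omega) hd (by omega)).symm

theorem commute_PhiW_neg_Bentry {l d : ℕ} (hl : l ≤ C.n) (hd : 1 ≤ d) {x : ℤ} (hx : x < 0)
    (k t : Fin l) : Commute (C.PhiW d x) (C.Bentry l k t) := by
  unfold Bentry
  have := k.2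
  split_ifs
  · exact C.commute_PhiW _ _ _ _
  · exact (C.commute_PhibarW_PhiW (by omega) hd (by omega)).symm

theorem commute_PhibarW_neg_Bentry {l d : ℕ} (hd : 1 ≤ d) {x : ℤ} (hx : x < 0)
    (k t : Fin l) : Commute (C.PhibarW d x) (C.Bentry l k t) := by
  unfold Bentry
  split_ifs
  · exact C.commute_PhibarW_PhiW hd (by omega) (by omega)
  · exact C.commute_PhibarW _ _ _ _

theorem commute_Bentry {l l' : ℕ} (hl : l ≤ C.n) (hl' : l' ≤ C.n) (k t : Fin l) (k' t' : Fin l') :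
    Commute (C.Bentry l k t) (C.Bentry l' k' t') := by
  have := k.2
  rw [Bentry]
  split_ifs
  · exact C.commute_PhiW_neg_Bentry hl' (by omega) (by omega) _ _
  · exact C.commute_PhibarW_neg_Bentry (by omega) (by omega) _ _

theorem commute_Bdet_Bcolrep {l l' : ℕ} (h : l' + l ≤ C.n) (pos x : ℤ) :
    Commute (C.Bdet l') (C.Bcolrep l pos fun row => -C.PhiW row x) := by
  refine ncdet_commute_ncdet fun a b a' b' => ?_
  split_ifs
  · have := a'.2
    exact (C.commute_PhiW_Bentry (by omega) (by omega) x a b).symm.neg_right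
  · exact C.commute_Bentry (by omega) (by omega) _ _ _ _

theorem commute_Bbar_Bcolrep {l : ℕ} (hn : C.n % 2 = 0) (h : l < C.n / 2) (pos x : ℤ) :
    Commute C.Bbar (C.Bcolrep l pos fun row => -C.PhiW row x) := by
  refine ncdet_commute_ncdet fun a b a' b' => ?_
  have := a'.2
  split_ifs
  · exact (C.commute_PhiW _ _ _ _).neg_right
  · exact C.commute_PhiW_neg_Bentry (by omega) (by omega) (by omega) _ _
  · exact (C.commute_PhibarW_PhiW (by omega) (by omega) (by omega)).neg_right
  · exact C.commute_PhibarW_neg_Bentry (by omega) (by omega) _ _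
  · exact (C.commute_PhiW_Bentry (by omega) (by omega) x a b).symm.neg_right
  · exact C.commute_Bentry (by omega) (by omega) _ _ _ _

theorem Bcolrep_smul_vac {l : ℕ} (hl : 1 ≤ l) (hln : l ≤ C.n / 2) {w x : ℤ} (hw : 1 ≤ w)
    (hw' : w ≤ C.lb2 l) (hx : -x ≤ C.lb1 l) :
    C.Bcolrep l (C.lb1 l + w) (fun row => -C.PhiW row x) • C.vac = 0 := by
  have hsum := C.lb1_add_lb2 hl
  have hcomm : ∀ a b a' b' : Fin l,
      Commute (if ((b : ℕ) : ℤ) + 1 = C.lb1 l + w then -C.PhiW ((a : ℕ) + 1) x else C.Bentry l a b)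
        (if ((b' : ℕ) : ℤ) + 1 = C.lb1 l + w then -C.PhiW ((a' : ℕ) + 1) x
          else C.Bentry l a' b') := by
    intro a b a' b'
    have := a.2
    have := a'.2
    split_ifs
    · exact (C.commute_PhiW _ _ _ _).neg_left.neg_right
    · exact (C.commute_PhiW_Bentry (by omega) (by omega) _ _ _).neg_left
    · exact (C.commute_PhiW_Bentry (by omega) (by omega) _ _ _).symm.neg_right
    · exact C.commute_Bentry (by omega) (by omega) _ _ _ _
  obtain ⟨s, hs⟩ : ∃ s : Fin l, ((s : ℕ) : ℤ) + 1 = C.lb1 l + w :=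
    ⟨⟨(C.lb1 l + w - 1).toNat, by omega⟩, by dsimp only; omega⟩
  rcases le_or_gt 0 x with h0 | h0
  · refine ncdet_smul_eq_zero hcomm s fun a => ?_
    rw [if_pos hs, neg_smul, C.PhiW_smul_vac _ h0, neg_zero]
  · obtain ⟨t, ht⟩ : ∃ t : Fin l, ((t : ℕ) : ℤ) + 1 = -x :=
      ⟨⟨(-x - 1).toNat, by omega⟩, by dsimp only; omega⟩
    have hzero : C.Bcolrep l (C.lb1 l + w) (fun row => -C.PhiW row x) = 0 := by
      refine ncdet_eq_zero_of_column_eq_neg hcomm (s := s) (t := t) ?_ fun a => ?_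
      · rintro rfl; omega
      · rw [if_pos hs, if_neg (by omega), Bentry, if_pos (by omega), ht, neg_neg]
    rw [hzero, zero_smul]

/-- `Σ_c φ^c_x φ^{n+1-c}_y`. -/
def PhiPhiSum (x y : ℤ) : C.W := ∑ c : Fin C.n, C.PhiW ((c : ℕ) + 1) x * C.PhiW (C.n - (c : ℕ)) y

theorem commute_PhiPhiSum_PhiW (x y : ℤ) (d : ℕ) (t : ℤ) :
    Commute (C.PhiPhiSum x y) (C.PhiW d t) :=
  Commute.sum_left _ _ _ fun _ _ =>
    (C.commute_PhiW _ _ _ _).mul_left (C.commute_PhiW _ _ _ _)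

theorem commutator_PhiPhiSum_PhibarW (x y : ℤ) {k : ℕ} (hk : k < C.n) (s : ℤ) :
    C.PhiPhiSum x y * C.PhibarW (C.n - k) s - C.PhibarW (C.n - k) s * C.PhiPhiSum x y
      = (if s + y + 1 = 0 then -C.PhiW (k + 1) x else 0)
        + (if s + x + 1 = 0 then -C.PhiW (k + 1) y else 0) := by
  have hterm (c : Fin C.n) :
      C.PhiW ((c : ℕ) + 1) x * C.PhiW (C.n - (c : ℕ)) y * C.PhibarW (C.n - k) s
          - C.PhibarW (C.n - k) s * (C.PhiW ((c : ℕ) + 1) x * C.PhiW (C.n - (c : ℕ)) y)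
        = (if c = ⟨k, hk⟩ then (if s + y + 1 = 0 then -C.PhiW (k + 1) x else 0) else 0)
          + (if c = ⟨C.n - 1 - k, by omega⟩ then
              (if s + x + 1 = 0 then -C.PhiW (k + 1) y else 0) else 0) := by
    have hc := c.2
    have h1 := C.PhibarW_mul_PhiW (c := C.n - k) (d := (c : ℕ) + 1) (by omega) (by omega)
      (by omega) (by omega) s x
    have h2 := C.PhibarW_mul_PhiW (c := C.n - k) (d := C.n - (c : ℕ)) (by omega) (by omega)
      (by omega) (by omega) s y
    have e1 : C.n - k = (c : ℕ) + 1 ↔ c = ⟨C.n - 1 - k, by omega⟩ := by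
      rw [Fin.ext_iff]; dsimp only; omega
    have e2 : C.n - k = C.n - (c : ℕ) ↔ c = ⟨k, hk⟩ := by
      rw [Fin.ext_iff]; dsimp only; omega
    rw [ite_and] at h1 h2
    rw [← mul_assoc, h1, add_mul, mul_assoc _ (C.PhibarW _ _), h2, mul_add, ← mul_assoc]
    simp only [e1, e2]
    have f1 : (if c = ⟨k, hk⟩ then (if s + y + 1 = 0 then -C.PhiW (k + 1) x else 0) else 0)
        = -(C.PhiW ((c : ℕ) + 1) x
          * if c = ⟨k, hk⟩ then (if s + y + 1 = 0 then 1 else 0) else 0) := by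
      split_ifs with h <;> simp [h]
    have f2 : (if c = ⟨C.n - 1 - k, by omega⟩ then
          (if s + x + 1 = 0 then -C.PhiW (k + 1) y else 0) else 0)
        = -((if c = ⟨C.n - 1 - k, by omega⟩ then (if s + x + 1 = 0 then 1 else 0) else 0)
          * C.PhiW (C.n - (c : ℕ)) y) := by
      split_ifs with h
      · have : C.n - (c : ℕ) = k + 1 := by rw [h]; dsimp only; omega
        simp [this]
      all_goals simp
    rw [f1, f2]
    abel
  rw [PhiPhiSum, Finset.sum_mul, Finset.mul_sum, ← Finset.sum_sub_distrib,
    Finset.sum_congr rfl fun c _ => hterm c, Finset.sum_add_distrib, Finset.sum_ite_eq',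
    Finset.sum_ite_eq', if_pos (Finset.mem_univ _), if_pos (Finset.mem_univ _)]

theorem sum_ncdet_replace {l : ℕ} (hl : 1 ≤ l) (w : ℤ) (col : ℕ → C.W) :
    (∑ s : Fin l, C.ncdet fun k t : Fin l =>
        if t = s then
          (if 1 ≤ w ∧ ((t : ℕ) : ℤ) + 1 = C.lb1 l + w then col ((k : ℕ) + 1) else 0)
        else C.Bentry l k t)
      = if 1 ≤ w ∧ w ≤ C.lb2 l then C.Bcolrep l (C.lb1 l + w) col else 0 := by
  have hsum := C.lb1_add_lb2 hl
  split_ifs with hw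
  · obtain ⟨s, hs⟩ : ∃ s : Fin l, ((s : ℕ) : ℤ) + 1 = C.lb1 l + w :=
      ⟨⟨(C.lb1 l + w - 1).toNat, by omega⟩, by dsimp only; omega⟩
    rw [Finset.sum_eq_single s]
    · rw [Bcolrep]
      congr 1
      funext k t
      by_cases hts : t = s
      · subst hts
        rw [if_pos rfl, if_pos ⟨hw.1, hs⟩, if_pos hs]
      · rw [if_neg hts, if_neg]
        intro h
        exact hts (Fin.ext (by omega))
    · intro t _ hts
      refine ncdet_eq_zero_of_column_zero t fun a => ?_
      rw [if_pos rfl, if_neg]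
      rintro ⟨-, h⟩
      exact hts (Fin.ext (by omega))
    · simp
  · refine Finset.sum_eq_zero fun s _ => ncdet_eq_zero_of_column_zero s fun a => ?_
    have := s.2
    rw [if_pos rfl, if_neg (by omega)]

theorem commutator_PhiPhiSum_Bdet {l : ℕ} (hl : 1 ≤ l) (hln : l ≤ C.n) (p q : ℤ) :
    C.PhiPhiSum (p - 1) (q - 1) * C.Bdet l - C.Bdet l * C.PhiPhiSum (p - 1) (q - 1)
      = (if 1 ≤ q ∧ q ≤ C.lb2 l then
          C.Bcolrep l (C.lb1 l + q) (fun row => -C.PhiW row (p - 1)) else 0)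
        + (if 1 ≤ p ∧ p ≤ C.lb2 l then
          C.Bcolrep l (C.lb1 l + p) (fun row => -C.PhiW row (q - 1)) else 0) := by
  rw [← C.sum_ncdet_replace hl, ← C.sum_ncdet_replace hl, ← Finset.sum_add_distrib, Bdet,
    commutator_ncdet _ _ (fun k t =>
      (if 1 ≤ q ∧ ((t : ℕ) : ℤ) + 1 = C.lb1 l + q then -C.PhiW ((k : ℕ) + 1) (p - 1) else 0)
      + (if 1 ≤ p ∧ ((t : ℕ) : ℤ) + 1 = C.lb1 l + p then -C.PhiW ((k : ℕ) + 1) (q - 1) else 0))]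
  · exact Finset.sum_congr rfl fun s _ => ncdet_replace_add _ _ _ s
  · intro k t
    have := k.2
    rw [Bentry]
    split_ifs with ht
    all_goals try omega
    · rw [(C.commute_PhiPhiSum_PhiW _ _ _ _).eq, sub_self, add_zero]
    all_goals
      rw [C.commutator_PhiPhiSum_PhibarW _ _ (by omega)]
      congr 1
      · first | rw [if_pos (by omega)] | rw [if_neg (by omega)]
      · first | rw [if_pos (by omega)] | rw [if_neg (by omega)]

end WCtx

open WCtx in
/-- **Lemma 5.14.**  For `1 ≤ i,j ≤ m`, `a ∈ ℤ`, `r ∈ S` (encoded by `k`),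
`1 ≤ l ≤ ⌊n/2⌋`, with `a > 0`, or `a = 0` and `S = ℤ + 1/2`: the commutator
`[Σ_c ψ_i^c(a-r)ψ_j^{n+1-c}(r), B_l]` equals `C_l^{r,i,j} + C̄_l^{r,i,j}`,
`C_l^{r,i,j}`, `C̄_l^{r,i,j}` or `0` according to whether `α(-r,0,j) ∈ I_{l̄₂}`
and/or `α(r,a,i) ∈ I_{l̄₂}`; moreover the modified determinants kill the vacuum
and commute with the appropriate `B_{l'}` and (for `n` even) with `B̄_{n/2}`.
(Here `-r` is encoded by the integer `-k - sig`.) -/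
theorem statement15 (C : WCtx) (i j : ℕ) (hi : 1 ≤ i) (hi' : i ≤ C.m)
    (hj : 1 ≤ j) (hj' : j ≤ C.m) (a k : ℤ) (l : ℕ) (hl : 1 ≤ l) (hl' : l ≤ C.n / 2)
    (ha : 0 < a ∨ (a = 0 ∧ C.sig = 1)) :
    (((1 ≤ C.alphaV (-k - C.sig) 0 j ∧ C.alphaV (-k - C.sig) 0 j ≤ (C.lb2 l : ℤ)) ∧
        (1 ≤ C.alphaV k a i ∧ C.alphaV k a i ≤ (C.lb2 l : ℤ))) →
      (∑ c : Fin C.n, C.psiS i ((c : ℕ) + 1) (a - k - C.sig) * C.psiS j (C.n - (c : ℕ)) k)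
          * C.Bdet l
        - C.Bdet l *
          (∑ c : Fin C.n, C.psiS i ((c : ℕ) + 1) (a - k - C.sig) * C.psiS j (C.n - (c : ℕ)) k)
        = C.Bcolrep l ((C.lb1 l : ℤ) + C.alphaV (-k - C.sig) 0 j)
            (fun row => -C.PhiW row (C.alphaV k a i - 1))
          + C.Bcolrep l ((C.lb1 l : ℤ) + C.alphaV k a i)
              (fun row => -C.PhiW row (C.alphaV (-k - C.sig) 0 j - 1)))
    ∧
    (((1 ≤ C.alphaV (-k - C.sig) 0 j ∧ C.alphaV (-k - C.sig) 0 j ≤ (C.lb2 l : ℤ)) ∧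
        ¬ (1 ≤ C.alphaV k a i ∧ C.alphaV k a i ≤ (C.lb2 l : ℤ))) →
      (∑ c : Fin C.n, C.psiS i ((c : ℕ) + 1) (a - k - C.sig) * C.psiS j (C.n - (c : ℕ)) k)
          * C.Bdet l
        - C.Bdet l *
          (∑ c : Fin C.n, C.psiS i ((c : ℕ) + 1) (a - k - C.sig) * C.psiS j (C.n - (c : ℕ)) k)
        = C.Bcolrep l ((C.lb1 l : ℤ) + C.alphaV (-k - C.sig) 0 j)
            (fun row => -C.PhiW row (C.alphaV k a i - 1)))
    ∧
    (((1 ≤ C.alphaV k a i ∧ C.alphaV k a i ≤ (C.lb2 l : ℤ)) ∧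
        ¬ (1 ≤ C.alphaV (-k - C.sig) 0 j ∧ C.alphaV (-k - C.sig) 0 j ≤ (C.lb2 l : ℤ))) →
      (∑ c : Fin C.n, C.psiS i ((c : ℕ) + 1) (a - k - C.sig) * C.psiS j (C.n - (c : ℕ)) k)
          * C.Bdet l
        - C.Bdet l *
          (∑ c : Fin C.n, C.psiS i ((c : ℕ) + 1) (a - k - C.sig) * C.psiS j (C.n - (c : ℕ)) k)
        = C.Bcolrep l ((C.lb1 l : ℤ) + C.alphaV k a i)
            (fun row => -C.PhiW row (C.alphaV (-k - C.sig) 0 j - 1)))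
    ∧
    ((¬ (1 ≤ C.alphaV (-k - C.sig) 0 j ∧ C.alphaV (-k - C.sig) 0 j ≤ (C.lb2 l : ℤ)) ∧
        ¬ (1 ≤ C.alphaV k a i ∧ C.alphaV k a i ≤ (C.lb2 l : ℤ))) →
      (∑ c : Fin C.n, C.psiS i ((c : ℕ) + 1) (a - k - C.sig) * C.psiS j (C.n - (c : ℕ)) k)
          * C.Bdet l
        - C.Bdet l *
          (∑ c : Fin C.n, C.psiS i ((c : ℕ) + 1) (a - k - C.sig) * C.psiS j (C.n - (c : ℕ)) k)
        = 0)
    ∧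
    ((1 ≤ C.alphaV (-k - C.sig) 0 j ∧ C.alphaV (-k - C.sig) 0 j ≤ (C.lb2 l : ℤ)) →
      (C.Bcolrep l ((C.lb1 l : ℤ) + C.alphaV (-k - C.sig) 0 j)
          (fun row => -C.PhiW row (C.alphaV k a i - 1))) • C.vac = 0
      ∧ (∀ l' : ℕ, 1 ≤ l' → l' + l ≤ C.n →
          C.Bdet l' * C.Bcolrep l ((C.lb1 l : ℤ) + C.alphaV (-k - C.sig) 0 j)
              (fun row => -C.PhiW row (C.alphaV k a i - 1))
            - C.Bcolrep l ((C.lb1 l : ℤ) + C.alphaV (-k - C.sig) 0 j)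
                (fun row => -C.PhiW row (C.alphaV k a i - 1)) * C.Bdet l' = 0)
      ∧ (C.n % 2 = 0 → ∀ l'' : ℕ, 1 ≤ l'' → l'' < C.n / 2 →
          (1 ≤ C.alphaV (-k - C.sig) 0 j ∧ C.alphaV (-k - C.sig) 0 j ≤ (C.lb2 l'' : ℤ)) →
          C.Bbar * C.Bcolrep l'' ((C.lb1 l'' : ℤ) + C.alphaV (-k - C.sig) 0 j)
              (fun row => -C.PhiW row (C.alphaV k a i - 1))
            - C.Bcolrep l'' ((C.lb1 l'' : ℤ) + C.alphaV (-k - C.sig) 0 j)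
                (fun row => -C.PhiW row (C.alphaV k a i - 1)) * C.Bbar = 0))
    ∧
    ((1 ≤ C.alphaV k a i ∧ C.alphaV k a i ≤ (C.lb2 l : ℤ)) →
      (C.Bcolrep l ((C.lb1 l : ℤ) + C.alphaV k a i)
          (fun row => -C.PhiW row (C.alphaV (-k - C.sig) 0 j - 1))) • C.vac = 0
      ∧ (∀ l' : ℕ, 1 ≤ l' → l' + l ≤ C.n →
          C.Bdet l' * C.Bcolrep l ((C.lb1 l : ℤ) + C.alphaV k a i)
              (fun row => -C.PhiW row (C.alphaV (-k - C.sig) 0 j - 1))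
            - C.Bcolrep l ((C.lb1 l : ℤ) + C.alphaV k a i)
                (fun row => -C.PhiW row (C.alphaV (-k - C.sig) 0 j - 1)) * C.Bdet l' = 0)
      ∧ (C.n % 2 = 0 → ∀ l'' : ℕ, 1 ≤ l'' → l'' < C.n / 2 →
          (1 ≤ C.alphaV k a i ∧ C.alphaV k a i ≤ (C.lb2 l'' : ℤ)) →
          C.Bbar * C.Bcolrep l'' ((C.lb1 l'' : ℤ) + C.alphaV k a i)
              (fun row => -C.PhiW row (C.alphaV (-k - C.sig) 0 j - 1))
            - C.Bcolrep l'' ((C.lb1 l'' : ℤ) + C.alphaV k a i)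
                (fun row => -C.PhiW row (C.alphaV (-k - C.sig) 0 j - 1)) * C.Bbar = 0)) := by
  have hX : (∑ c : Fin C.n, C.psiS i ((c : ℕ) + 1) (a - k - C.sig) * C.psiS j (C.n - (c : ℕ)) k)
      = C.PhiPhiSum (C.alphaV k a i - 1) (C.alphaV (-k - C.sig) 0 j - 1) :=
    Finset.sum_congr rfl fun c _ => by
      rw [C.psiS_eq_PhiW hi hi', ← C.psiS_eq_PhiW hj hj']
      congr 2
      ring
  have hcomm := C.commutator_PhiPhiSum_Bdet hl (by omega) (C.alphaV k a i)
    (C.alphaV (-k - C.sig) 0 j)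
  have hb : 1 ≤ a + C.sig := by
    rcases C.hsig with h | h <;> omega
  rw [hX, hcomm]
  refine ⟨fun h => ?_, fun h => ?_, fun h => ?_, fun h => ?_, fun h => ⟨?_, ?_, ?_⟩,
    fun h => ⟨?_, ?_, ?_⟩⟩
  · rw [if_pos h.1, if_pos h.2]
  · rw [if_pos h.1, if_neg h.2, add_zero]
  · rw [if_neg h.2, if_pos h.1, zero_add]
  · rw [if_neg h.1, if_neg h.2, add_zero]
  · refine C.Bcolrep_smul_vac hl hl' h.1 h.2 ?_
    have := C.neg_le_lb1 (i := i) (K := k + C.sig) hl hj' hi' hb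
      (by have := h.2; rw [alphaV] at this; linarith)
    rw [alphaV_sub_one]
    linarith
  · exact fun l' _ h' => sub_eq_zero.2 (C.commute_Bdet_Bcolrep h' _ _).eq
  · exact fun hn l' _ h' _ => sub_eq_zero.2 (C.commute_Bbar_Bcolrep hn h' _ _).eq
  · refine C.Bcolrep_smul_vac hl hl' h.1 h.2 ?_
    have := C.neg_le_lb1 (i := j) (K := a - k) hl hi' hj' hb
      (by have := h.2; rw [alphaV] at this; linarith)
    rw [alphaV_sub_one]
    linarith
  · exact fun l' _ h' => sub_eq_zero.2 (C.commute_Bdet_Bcolrep h' _ _).eq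
  · exact fun hn l' _ h' _ => sub_eq_zero.2 (C.commute_Bbar_Bcolrep hn h' _ _).eq
end
end
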